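/- arXiv:2405.12170 — 2 statements merged into one kernel-verified Lean document; each statement's English description precedes it below -/
import Mathlib

section
/- Let (R, 𝔪) be a Cohen–Macaulay Noetherian local ring, let 𝔞 = (a_1, …, a_s) ⊆ I = (f_1, …, f_r) be ideals of R, and suppose J = 𝔞 :_R I is an s-residual intersection of I (i.e., J is a proper ideal with ht(J) ≥ s) with s ≤ ht(I) + 1. Choose c_{ij} ∈ R with a_j = Σ_{i=1}^r c_{ij} f_i, let S = R[U_{ij} : 1 ≤ i ≤ r, 1 ≤ j ≤ s] be the polynomial ring over R in rs indeterminates, set a'_j = Σ_{i=1}^r U_{ij} f_i, R(s, f) = (a'_1, …, a'_s) :_S IS, and let x denote the sequence U_{11} − c_{11}, …, U_{rs} − c_{rs} in S. Then for every maximal ideal 𝔫 of S containing R(s, f) + (x), there is a ring isomorphism S_𝔫/(R(s, f) + (x))S_𝔫 ≅ R/J; together with the regularity of the sequence x on S_𝔫 and on S_𝔫/R(s, f)S_𝔫, this says that the pair (S_𝔫, R(s, f)S_𝔫) is a deformation of the pair (R, J). -/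
open MvPolynomial

/-- The height of an ideal: the infimum of the heights (in the prime spectrum, ordered by
inclusion) of the prime ideals containing it. -/
noncomputable def idealHeight {A : Type*} [CommRing A] (I : Ideal A) : ℕ∞ :=
  ⨅ (p : PrimeSpectrum A) (_ : I ≤ p.asIdeal), Order.height p

/-- The depth of a local ring: the supremum of the lengths of regular sequences
consisting of elements of the maximal ideal. -/
noncomputable def ringDepth (R : Type*) [CommRing R] [IsLocalRing R] : ℕ∞ :=
  ⨆ (rs : List R) (_ : ∀ x ∈ rs, x ∈ IsLocalRing.maximalIdeal R)
    (_ : RingTheory.Sequence.IsRegular R rs), (rs.length : ℕ∞)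

/-- A Noetherian local ring is Cohen–Macaulay if `depth R = dim R`. -/
def IsCohenMacaulayLocalRing (R : Type*) [CommRing R] [IsLocalRing R] : Prop :=
  (ringDepth R : WithBot ℕ∞) = ringKrullDim R

/-- The generic `s`-residual `R(s, f) = (a'₁, …, a'_s) :_S IS` of the generating set
`f = f₁, …, f_r` of `I`, where `S = R[U_{ij}]` and `a'_j = Σᵢ U_{ij} fᵢ`. -/
noncomputable def genericResidual {R : Type*} [CommRing R] (r s : ℕ) (f : Fin r → R) :
    Ideal (MvPolynomial (Fin r × Fin s) R) :=
  Submodule.colon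
    (Ideal.span (Set.range fun j : Fin s =>
      ∑ i : Fin r, (X (i, j) : MvPolynomial (Fin r × Fin s) R) * C (f i)))
    ((Ideal.span (Set.range f)).map (C : R →+* MvPolynomial (Fin r × Fin s) R))

universe u

open CategoryTheory Abelian Pointwise in
theorem exists_isRegular_quotSMulTop {R M : Type u} [CommRing R] [IsNoetherianRing R]
    [IsLocalRing R] [AddCommGroup M] [Module R M] [Module.Finite R M] {n : ℕ} {b : R}
    (hb : b ∈ IsLocalRing.maximalIdeal R) (hreg : IsSMulRegular M b)
    {rs : List R} (hlen : rs.length = n + 1) (hmem : ∀ x ∈ rs, x ∈ IsLocalRing.maximalIdeal R)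
    (hrs : RingTheory.Sequence.IsRegular M rs) :
    ∃ rs' : List R, rs'.length = n ∧ (∀ x ∈ rs', x ∈ IsLocalRing.maximalIdeal R) ∧
      RingTheory.Sequence.IsRegular (QuotSMulTop b M) rs' := by
  have : Nontrivial M := hrs.nontrivial
  have key (N : Type u) [AddCommGroup N] [Module R N] [Module.Finite R N] [Nontrivial N] :
      IsLocalRing.maximalIdeal R • (⊤ : Submodule R N) < ⊤ :=
    lt_top_iff_ne_top.mpr fun h ↦ (Submodule.top_ne_ideal_smul_of_le_jacobson_annihilator
      (IsLocalRing.maximalIdeal_le_jacobson _)) h.symm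
  have : Nontrivial (QuotSMulTop b M) := by
    refine Submodule.Quotient.nontrivial_iff.mpr (ne_of_lt (lt_of_le_of_lt ?_ (key M)))
    rw [← Submodule.ideal_span_singleton_smul]
    exact Submodule.smul_mono_left ((Ideal.span_singleton_le_iff_mem _).mpr hb)
  let I := IsLocalRing.maximalIdeal R
  let N : ModuleCat R := ModuleCat.of R (Shrink (R ⧸ I))
  have h34 := (ModuleCat.exists_isRegular_tfae I (n + 1) (ModuleCat.of R M) (key M)).out 1 3
  have h := h34.mpr ⟨rs, hlen, hmem, hrs⟩
  refine ((ModuleCat.exists_isRegular_tfae I n (ModuleCat.of R (QuotSMulTop b M))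
    (key _)).out 1 3).mp fun i hi ↦ ?_
  have zero1 := AddCommGrpCat.isZero_of_iff_subsingleton.mpr (h i (by omega))
  have zero2 := AddCommGrpCat.isZero_of_iff_subsingleton.mpr (h (i + 1) (by omega))
  exact AddCommGrpCat.subsingleton_of_isZero <| ShortComplex.Exact.isZero_of_both_zeros
    ((Ext.covariant_sequence_exact₃' N (IsSMulRegular.smulShortComplex_shortExact
      (M := ModuleCat.of R M) hreg)) i (i + 1) rfl)
    (zero1.eq_zero_of_src _) (zero2.eq_zero_of_tgt _)

open Pointwise in
theorem exists_associatedPrimes_lt {R M : Type*} [CommRing R] [IsNoetherianRing R] [IsLocalRing R]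
    [AddCommGroup M] [Module R M] [Module.Finite R M] {z : R}
    (hz : z ∈ IsLocalRing.maximalIdeal R) (hreg : IsSMulRegular M z)
    {p : Ideal R} (hp : p ∈ associatedPrimes R M) :
    ∃ q ∈ associatedPrimes R (QuotSMulTop z M), p < q := by
  obtain ⟨hpp, m, hm⟩ := isAssociatedPrime_iff.mp hp
  have hm0 : m ≠ 0 := by
    rintro rfl
    exact hpp.ne_top (by simp [hm])
  let N : Submodule R M :=
    { carrier := {x | ∀ t ∈ p, t • x = 0}
      add_mem' := fun ha hb t ht ↦ by simp [ha t ht, hb t ht]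
      zero_mem' := fun t _ ↦ smul_zero t
      smul_mem' := fun c x hx t ht ↦ by rw [smul_comm, hx t ht, smul_zero] }
  have hmN : m ∈ N := fun t ht ↦ by
    rw [hm] at ht
    simpa [Submodule.mem_colon_singleton] using ht
  obtain ⟨x, hxN, hx⟩ : ∃ x ∈ N, Submodule.Quotient.mk (p := z • (⊤ : Submodule R M)) x ≠ 0 := by
    by_contra! hcon
    have hN : N ≤ IsLocalRing.maximalIdeal R • N := by
      intro x hx
      have h := hcon x hx
      rw [Submodule.Quotient.mk_eq_zero] at h
      obtain ⟨y, -, rfl⟩ := h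
      refine Submodule.smul_mem_smul hz fun t ht ↦ hreg ?_
      simpa [smul_comm z t] using hx t ht
    have := Submodule.eq_bot_of_le_smul_of_le_jacobson_bot _ N (IsNoetherian.noetherian N) hN
      (IsLocalRing.maximalIdeal_le_jacobson _)
    exact hm0 (by simpa [this] using hmN)
  obtain ⟨q, hq, hle⟩ := exists_le_isAssociatedPrime_of_isNoetherianRing R _ hx
  refine ⟨q, hq, lt_of_le_of_ne (fun t ht ↦ hle ?_) ?_⟩
  · rw [Submodule.mem_colon_singleton, ← Submodule.Quotient.mk_smul, hxN t ht]
    simp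
  · rintro rfl
    have hzp : z ∈ p := hle (by
      rw [Submodule.mem_colon_singleton, ← Submodule.Quotient.mk_smul, Submodule.mem_bot,
        Submodule.Quotient.mk_eq_zero]
      exact Submodule.smul_mem_pointwise_smul x z ⊤ Submodule.mem_top)
    rw [hm, Submodule.mem_colon_singleton, Submodule.mem_bot] at hzp
    exact hm0 (hreg (by simpa using hzp))

theorem length_le_coheight_of_mem_associatedPrimes {R M : Type*} [CommRing R] [IsNoetherianRing R]
    [IsLocalRing R] [AddCommGroup M] [Module R M] [Module.Finite R M] {rs : List R}
    (hmem : ∀ x ∈ rs, x ∈ IsLocalRing.maximalIdeal R)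
    (hrs : RingTheory.Sequence.IsWeaklyRegular M rs) (p : PrimeSpectrum R)
    (hp : p.asIdeal ∈ associatedPrimes R M) : (rs.length : ℕ∞) ≤ Order.coheight p := by
  induction rs generalizing M p with
  | nil => simp
  | cons z rs ih =>
    rw [RingTheory.Sequence.isWeaklyRegular_cons_iff] at hrs
    obtain ⟨q, hq, hlt⟩ := exists_associatedPrimes_lt (hmem z (by simp)) hrs.1 hp
    have h := ih (fun x hx ↦ hmem x (by simp [hx])) hrs.2 ⟨q, hq.isPrime⟩ hq
    have hpq : p < (⟨q, hq.isPrime⟩ : PrimeSpectrum R) := hlt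
    calc ((z :: rs).length : ℕ∞) = rs.length + 1 := by simp
      _ ≤ Order.coheight (⟨q, hq.isPrime⟩ : PrimeSpectrum R) + 1 := by gcongr
      _ ≤ _ := Order.coheight_add_one_le hpq

/-- If a finite module over a local ring has a regular sequence of length `n`, then the associated
primes of its quotient by a weakly regular sequence `bs` have coheight at least `n - bs.length`. -/
theorem length_le_length_add_coheight {R : Type u} [CommRing R] [IsNoetherianRing R]
    [IsLocalRing R] {M : Type u} [AddCommGroup M] [Module R M] [Module.Finite R M] {n : ℕ}
    {rs bs : List R} (hmem : ∀ x ∈ rs, x ∈ IsLocalRing.maximalIdeal R)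
    (hrs : RingTheory.Sequence.IsRegular M rs) (hn : rs.length = n)
    (hbmem : ∀ x ∈ bs, x ∈ IsLocalRing.maximalIdeal R)
    (hbs : RingTheory.Sequence.IsWeaklyRegular M bs)
    (p : PrimeSpectrum R)
    (hp : p.asIdeal ∈ associatedPrimes R (M ⧸ Ideal.ofList bs • (⊤ : Submodule R M))) :
    (n : ℕ∞) ≤ bs.length + Order.coheight p := by
  induction bs generalizing M rs n with
  | nil =>
    subst hn
    have : p.asIdeal ∈ associatedPrimes R M := by
      have e : (M ⧸ Ideal.ofList ([] : List R) • (⊤ : Submodule R M)) ≃ₗ[R] M :=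
        Submodule.quotEquivOfEqBot _ (by simp)
      exact (LinearEquiv.AssociatedPrimes.eq e) ▸ hp
    simpa using length_le_coheight_of_mem_associatedPrimes hmem hrs.toIsWeaklyRegular p this
  | cons b bs ih =>
    rw [RingTheory.Sequence.isWeaklyRegular_cons_iff] at hbs
    obtain _ | n := n
    · simp
    obtain ⟨rs', h1, h2, h3⟩ :=
      exists_isRegular_quotSMulTop (hbmem b (by simp)) hbs.1 hn hmem hrs
    have := ih h2 h3 h1 (fun x hx ↦ hbmem x (by simp [hx])) hbs.2 (by
      have e := Submodule.quotOfListConsSMulTopEquivQuotSMulTopInner M b bs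
      exact (LinearEquiv.AssociatedPrimes.eq e) ▸ hp)
    calc ((n + 1 : ℕ) : ℕ∞) = n + 1 := by simp
      _ ≤ (bs.length + Order.coheight p) + 1 := by gcongr
      _ = _ := by push_cast [List.length_cons]; ring

theorem IsCohenMacaulayLocalRing.height_le_length {R : Type*} [CommRing R] [IsNoetherianRing R]
    [IsLocalRing R] (hCM : IsCohenMacaulayLocalRing R) {bs : List R}
    (hbmem : ∀ x ∈ bs, x ∈ IsLocalRing.maximalIdeal R)
    (hbs : RingTheory.Sequence.IsWeaklyRegular R bs) (p : PrimeSpectrum R)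
    (hp : p.asIdeal ∈ associatedPrimes R (R ⧸ Ideal.ofList bs)) :
    Order.height p ≤ bs.length := by
  have e : (R ⧸ Ideal.ofList bs • (⊤ : Submodule R R)) ≃ₗ[R] R ⧸ Ideal.ofList bs :=
    Submodule.quotEquivOfEq _ _ (by simp)
  rw [← LinearEquiv.AssociatedPrimes.eq e] at hp
  have h1 : ringDepth R ≤ bs.length + Order.coheight p :=
    iSup_le fun rs ↦ iSup_le fun hmem ↦ iSup_le fun hrs ↦
      length_le_length_add_coheight hmem hrs rfl hbmem hbs p hp
  have h2 : ((Order.height p + Order.coheight p : ℕ∞) : WithBot ℕ∞) ≤ ringKrullDim R := by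
    rw [ringKrullDim, Order.krullDim_eq_iSup_height_add_coheight_of_nonempty]
    exact WithBot.coe_le_coe.mpr (le_iSup (fun a : PrimeSpectrum R ↦
      Order.height a + Order.coheight a) p)
  rw [← hCM, WithBot.coe_le_coe] at h2
  have hfin : Order.coheight p ≠ ⊤ := by
    intro h
    have h3 := Order.coheight_le_krullDim p
    rw [h] at h3
    exact (ringKrullDim_lt_top (R := R)).not_ge h3
  exact (ENat.add_le_add_iff_right hfin).mp (h2.trans h1)

theorem isWeaklyRegular_append_singleton_iff {B : Type*} [CommRing B] {bs : List B} {z : B} :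
    RingTheory.Sequence.IsWeaklyRegular B (bs ++ [z]) ↔
      RingTheory.Sequence.IsWeaklyRegular B bs ∧
        ∀ y, z * y ∈ Ideal.ofList bs → y ∈ Ideal.ofList bs := by
  rw [RingTheory.Sequence.isWeaklyRegular_append_iff,
    RingTheory.Sequence.isWeaklyRegular_singleton_iff, isSMulRegular_quotient_iff_mem_of_smul_mem]
  simp

theorem isWeaklyRegular_quotient_append_singleton_iff {B : Type*} [CommRing B] {K : Ideal B}
    {bs : List B} {z : B} :
    RingTheory.Sequence.IsWeaklyRegular (B ⧸ K) (bs ++ [z]) ↔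
      RingTheory.Sequence.IsWeaklyRegular (B ⧸ K) bs ∧
        ∀ y, z * y ∈ K ⊔ Ideal.ofList bs → y ∈ K ⊔ Ideal.ofList bs := by
  have h (y : B) : Ideal.Quotient.mk K y ∈ Ideal.ofList bs • (⊤ : Submodule B (B ⧸ K)) ↔
      y ∈ K ⊔ Ideal.ofList bs := by
    have : Ideal.ofList bs • (⊤ : Submodule B (B ⧸ K)) =
        Submodule.map K.mkQ (Ideal.ofList bs) := by
      rw [← Submodule.range_mkQ K, ← Submodule.map_top, ← Submodule.map_smul'']
      simp
    rw [this, show Ideal.Quotient.mk K y = K.mkQ y from rfl, ← Submodule.mem_comap,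
      Submodule.comap_map_mkQ]
  rw [RingTheory.Sequence.isWeaklyRegular_append_iff,
    RingTheory.Sequence.isWeaklyRegular_singleton_iff, isSMulRegular_quotient_iff_mem_of_smul_mem]
  refine and_congr_right fun _ ↦ ⟨fun H y hy ↦ (h y).mp (H _ ?_), fun H y ↦ ?_⟩
  · exact (h (z * y)).mpr hy
  · obtain ⟨y, rfl⟩ := Ideal.Quotient.mk_surjective y
    exact fun hy ↦ (h y).mpr (H y ((h (z * y)).mp hy))

theorem isWeaklyRegular_append_singleton_of_forall_notMem {R : Type*} [CommRing R]
    [IsNoetherianRing R] {bs : List R} {z : R}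
    (hbs : RingTheory.Sequence.IsWeaklyRegular R bs)
    (hz : ∀ P ∈ associatedPrimes R (R ⧸ Ideal.ofList bs), z ∉ P) :
    RingTheory.Sequence.IsWeaklyRegular R (bs ++ [z]) := by
  have h : IsSMulRegular (R ⧸ Ideal.ofList bs) z := by
    by_contra hcon
    have : z ∈ ⋃ p ∈ associatedPrimes R (R ⧸ Ideal.ofList bs), (p : Set R) := by
      rw [biUnion_associatedPrimes_eq_compl_regular]
      exact hcon
    simp only [Set.mem_iUnion] at this
    obtain ⟨P, hP, hzP⟩ := this
    exact hz P hP hzP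
  rw [isWeaklyRegular_append_singleton_iff]
  exact ⟨hbs, (isSMulRegular_quotient_iff_mem_of_smul_mem _ _).mp h⟩

/-- Prime avoidance for cosets. -/
theorem exists_add_notMem_of_finite {R : Type*} [CommRing R] {S : Set (Ideal R)} (hS : S.Finite)
    (hprime : ∀ P ∈ S, P.IsPrime) (a : R) (𝔠 : Ideal R)
    (h : ∀ P ∈ S, ¬ Ideal.span {a} ⊔ 𝔠 ≤ P) : ∃ t ∈ 𝔠, ∀ P ∈ S, a + t ∉ P := by
  classical
  let S' : Set (Ideal R) := {P | Maximal (· ∈ S) P}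
  have hS'S : S' ⊆ S := fun P hP ↦ hP.prop
  let B : Finset (Ideal R) := (hS.subset (hS'S.trans' (Set.sep_subset S' (a ∉ ·)))).toFinset
  have hB (Q : Ideal R) : Q ∈ B ↔ Q ∈ S' ∧ a ∉ Q := by simp [B]
  let A : Set (Ideal R) := {P ∈ S' | a ∈ P}
  have hA : A.Finite := hS.subset (hS'S.trans' (Set.sep_subset S' (a ∈ ·)))
  have key : ¬ ((𝔠 ⊓ B.inf id : Ideal R) : Set R) ⊆ ⋃ P ∈ A, (P : Set R) := by
    intro hsub
    obtain ⟨P, ⟨hPS, haP⟩, hle⟩ := (Ideal.subset_union_prime_finite hA (f := id) ⊥ ⊥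
      fun i hi _ _ ↦ hprime i (hS'S hi.1)).mp hsub
    have hPp := hprime P (hS'S hPS)
    rcases hPp.inf_le.mp hle with h1 | h1
    · exact h P (hS'S hPS) (sup_le ((Ideal.span_singleton_le_iff_mem P).mpr haP) h1)
    · obtain ⟨Q, hQ, hQP⟩ := hPp.inf_le'.mp h1
      obtain ⟨hQS, haQ⟩ := (hB Q).mp hQ
      exact haQ (hQS.le_of_ge (hS'S hPS) hQP haP)
  obtain ⟨t, ht, htA⟩ := Set.not_subset.mp key
  refine ⟨t, ht.1, fun P hP hmem ↦ ?_⟩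
  obtain ⟨Q, hPQ, hQ⟩ := hS.exists_le_maximal hP
  replace hmem := hPQ hmem
  by_cases haQ : a ∈ Q
  · exact htA (Set.mem_biUnion (show Q ∈ A from ⟨hQ, haQ⟩) ((Q.add_mem_iff_right haQ).mp hmem))
  · have htQ : t ∈ Q := (Finset.inf_le ((hB Q).mpr ⟨hQ, haQ⟩) : B.inf id ≤ id Q) ht.2
    exact haQ ((Q.add_mem_iff_left htQ).mp hmem)

/-- Elements in general position: the generators of an ideal contained in no associated prime
of a quotient by a short regular sequence may be modified by elementary transformations
so that every short subfamily of them is a regular sequence. -/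
theorem exists_generators_isWeaklyRegular {R : Type*} [CommRing R] [IsNoetherianRing R]
    [IsLocalRing R] {s : ℕ} (P : (Fin s → R) → Prop) (𝔞 : Ideal R)
    (h𝔞 : 𝔞 ≤ IsLocalRing.maximalIdeal R)
    (hspan : ∀ b, P b → Ideal.span (Set.range b) = 𝔞)
    (hstep : ∀ b (t : Fin s) (l : Fin s → R), P b → l t = 0 →
      P (Function.update b t (b t + ∑ j, l j * b j)))
    (hav : ∀ bs : List R, (∀ x ∈ bs, x ∈ IsLocalRing.maximalIdeal R) →
      RingTheory.Sequence.IsWeaklyRegular R bs → bs.length + 2 ≤ s →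
      ∀ Q ∈ associatedPrimes R (R ⧸ Ideal.ofList bs), ¬ 𝔞 ≤ Q)
    (a : Fin s → R) (ha : P a) :
    ∃ b, P b ∧ ∀ T : Finset (Fin s), T.card + 1 ≤ s →
      RingTheory.Sequence.IsWeaklyRegular R (T.toList.map b) := by
  classical
  suffices H : ∀ t ≤ s, ∃ b, P b ∧ ∀ T : Finset (Fin s), (∀ j ∈ T, j.val < t) → T.card + 1 ≤ s →
      RingTheory.Sequence.IsWeaklyRegular R (T.toList.map b) by
    obtain ⟨b, hb, h⟩ := H s le_rfl
    exact ⟨b, hb, fun T ↦ h T fun j _ ↦ j.2⟩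
  intro t ht
  induction t with
  | zero =>
    refine ⟨a, ha, fun T hT _ ↦ ?_⟩
    obtain rfl : T = ∅ := Finset.eq_empty_of_forall_notMem fun j hj ↦ by simpa using hT j hj
    simp
  | succ t ih =>
    obtain ⟨b, hb, hreg⟩ := ih (by omega)
    have hmem (b : Fin s → R) (hb : P b) (T : Finset (Fin s)) :
        ∀ x ∈ T.toList.map b, x ∈ IsLocalRing.maximalIdeal R := by
      intro x hx
      obtain ⟨j, -, rfl⟩ := List.mem_map.mp hx
      exact h𝔞 (hspan b hb ▸ Ideal.subset_span ⟨j, rfl⟩)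
    let τ : Fin s := ⟨t, ht⟩
    let F : Set (Finset (Fin s)) := {T | (∀ j ∈ T, j.val < t) ∧ T.card + 2 ≤ s}
    let S : Set (Ideal R) :=
      ⋃ T ∈ F, associatedPrimes R (R ⧸ Ideal.ofList (T.toList.map b))
    have hSfin : S.Finite :=
      (Set.toFinite F).biUnion fun T _ ↦ associatedPrimes.finite _ _
    have hSprime : ∀ Q ∈ S, Q.IsPrime := by
      intro Q hQ
      simp only [S, Set.mem_iUnion] at hQ
      obtain ⟨T, -, hQ⟩ := hQ
      exact hQ.isPrime
    obtain ⟨z, hz, hzS⟩ := exists_add_notMem_of_finite hSfin hSprime (b τ)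
      (Ideal.span (Set.range (Function.update b τ 0))) (by
        intro Q hQ hle
        simp only [S, Set.mem_iUnion] at hQ
        obtain ⟨T, ⟨hT, hTs⟩, hQ⟩ := hQ
        refine hav _ (hmem b hb T) (hreg T hT (by omega)) (by simpa using hTs) Q hQ ?_
        rw [← hspan b hb, Ideal.span_le]
        rintro - ⟨j, rfl⟩
        by_cases hj : j = τ
        · subst hj
          exact hle (Ideal.mem_sup_left (Ideal.mem_span_singleton_self _))
        · exact hle (Ideal.mem_sup_right (Ideal.subset_span ⟨j, by simp [hj]⟩)))
    obtain ⟨μ, rfl⟩ := Ideal.mem_span_range_iff_exists_fun.mp hz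
    have hμ : ∑ j, μ j * Function.update b τ 0 j = ∑ j, Function.update μ τ 0 j * b j := by
      refine Finset.sum_congr rfl fun j _ ↦ ?_
      by_cases hj : j = τ
      · subst hj; simp
      · simp [hj]
    rw [hμ] at hzS
    have hb' := hstep b τ (Function.update μ τ 0) hb (by simp)
    refine ⟨_, hb', fun T hT hTs ↦ ?_⟩
    set b' := Function.update b τ (b τ + ∑ j, Function.update μ τ 0 j * b j) with hb'def
    have hcongr (T : Finset (Fin s)) (hτ : τ ∉ T) : T.toList.map b' = T.toList.map b := by
      refine List.map_congr_left fun j hj ↦ ?_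
      have : j ≠ τ := by rintro rfl; simp at hj; exact hτ hj
      simp [hb'def, this]
    have hlt (j : Fin s) (hj : j ∈ T) (hne : j ≠ τ) : j.val < t := by
      have h1 := hT j hj
      have h2 : j.val ≠ t := fun h ↦ hne (Fin.ext h)
      omega
    by_cases hτ : τ ∈ T
    · have hcard := Finset.card_erase_add_one hτ
      have hT' : ∀ j ∈ T.erase τ, j.val < t := fun j hj ↦
        hlt j (Finset.mem_of_mem_erase hj) (Finset.ne_of_mem_erase hj)
      have h1 : RingTheory.Sequence.IsWeaklyRegular R ((T.erase τ).toList.map b' ++ [b' τ]) := by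
        rw [hcongr _ (Finset.notMem_erase τ T)]
        refine isWeaklyRegular_append_singleton_of_forall_notMem (hreg _ hT' (by omega))
          fun Q hQ ↦ ?_
        rw [hb'def, Function.update_self]
        exact hzS Q (Set.mem_biUnion (show T.erase τ ∈ F from ⟨hT', by omega⟩) hQ)
      have hperm : ((T.erase τ).toList ++ [τ]).Perm T.toList := by
        refine (List.perm_append_singleton _ _).trans ?_
        rw [← Multiset.coe_eq_coe, ← Multiset.cons_coe, Finset.coe_toList, Finset.coe_toList,
          Finset.erase_val, Multiset.cons_erase hτ]
      have h2 := hperm.map b'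
      rw [List.map_append] at h2
      refine IsLocalRing.isWeaklyRegular_of_perm_of_subset_maximalIdeal h1 h2 fun x hx ↦ ?_
      exact hmem b' hb' T x (h2.subset hx)
    · rw [hcongr T hτ]
      exact hreg T (fun j hj ↦ hlt j hj fun h ↦ hτ (h ▸ hj)) hTs

theorem IsCohenMacaulayLocalRing.exists_residual_generators {R : Type*} [CommRing R]
    [IsNoetherianRing R] [IsLocalRing R] (hCM : IsCohenMacaulayLocalRing R) {s : ℕ}
    {𝔞 I : Ideal R} (hproper : 𝔞.colon (I : Set R) ≠ ⊤)
    (hJ : (s : ℕ∞) ≤ idealHeight (𝔞.colon (I : Set R))) (hI : (s : ℕ∞) ≤ idealHeight I + 1)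
    (P : (Fin s → R) → Prop) (hspan : ∀ b, P b → Ideal.span (Set.range b) = 𝔞)
    (hstep : ∀ b (t : Fin s) (l : Fin s → R), P b → l t = 0 →
      P (Function.update b t (b t + ∑ j, l j * b j)))
    (a : Fin s → R) (ha : P a) :
    ∃ b, P b ∧ ∀ k, ∃ N ∈ 𝔞.colon (I : Set R), RingTheory.Sequence.IsWeaklyRegular R
      ((Finset.univ.erase k).toList.map b ++ [N]) := by
  have h𝔞J : 𝔞 ≤ 𝔞.colon (I : Set R) := fun x hx ↦
    Submodule.mem_colon.mpr fun y _ ↦ 𝔞.mul_mem_right y hx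
  have hIJ : I * 𝔞.colon (I : Set R) ≤ 𝔞 := Ideal.mul_le.mpr fun x hx y hy ↦ by
    rw [mul_comm]
    exact Submodule.mem_colon.mp hy x hx
  have h𝔞 : 𝔞 ≤ IsLocalRing.maximalIdeal R := h𝔞J.trans (IsLocalRing.le_maximalIdeal hproper)
  have hheight (bs : List R) (hbs : ∀ x ∈ bs, x ∈ IsLocalRing.maximalIdeal R)
      (hreg : RingTheory.Sequence.IsWeaklyRegular R bs) (Q : Ideal R)
      (hQ : Q ∈ associatedPrimes R (R ⧸ Ideal.ofList bs)) (𝔟 : Ideal R) (hle : 𝔟 ≤ Q) :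
      idealHeight 𝔟 ≤ bs.length :=
    (iInf₂_le (⟨Q, hQ.isPrime⟩ : PrimeSpectrum R) hle).trans
      (hCM.height_le_length hbs hreg ⟨Q, hQ.isPrime⟩ hQ)
  obtain ⟨b, hb, hreg⟩ := exists_generators_isWeaklyRegular P 𝔞 h𝔞 hspan hstep (by
    intro bs hbs hreg hlen Q hQ hle
    rcases hQ.isPrime.mul_le.mp (hIJ.trans hle) with h | h
    · have h1 := hI.trans (add_le_add_left (hheight bs hbs hreg Q hQ I h) 1)
      norm_cast at h1
      omega
    · have h1 := hJ.trans (hheight bs hbs hreg Q hQ _ h)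
      norm_cast at h1
      omega) a ha
  refine ⟨b, hb, fun k ↦ ?_⟩
  have hcard : (Finset.univ.erase k).card + 1 = s := by
    rw [Finset.card_erase_add_one (Finset.mem_univ k), Finset.card_univ, Fintype.card_fin]
  have hreg' := hreg (Finset.univ.erase k) hcard.le
  set bs := (Finset.univ.erase k).toList.map b with hbsdef
  have hbs : ∀ x ∈ bs, x ∈ IsLocalRing.maximalIdeal R := by
    intro x hx
    obtain ⟨j, -, rfl⟩ := List.mem_map.mp hx
    exact h𝔞 (hspan b hb ▸ Ideal.subset_span ⟨j, rfl⟩)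
  have hlen : bs.length + 1 = s := by simpa [bs] using hcard
  have key : ¬ ((𝔞.colon (I : Set R) : Ideal R) : Set R) ⊆
      ⋃ Q ∈ associatedPrimes R (R ⧸ Ideal.ofList bs), (Q : Set R) := by
    intro hsub
    obtain ⟨Q, hQ, hle⟩ := (Ideal.subset_union_prime_finite (associatedPrimes.finite R _)
      (f := id) ⊥ ⊥ fun i hi _ _ ↦ hi.isPrime).mp hsub
    have h1 := hJ.trans (hheight bs hbs hreg' Q hQ _ hle)
    norm_cast at h1
    omega
  obtain ⟨N, hN, hNQ⟩ := Set.not_subset.mp key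
  exact ⟨N, hN, isWeaklyRegular_append_singleton_of_forall_notMem hreg' fun Q hQ hmem ↦
    hNQ (Set.mem_biUnion hQ hmem)⟩

theorem mem_sup_span_singleton_iff {B : Type*} [CommRing B] {𝔟 : Ideal B} {a z : B} :
    z ∈ 𝔟 ⊔ Ideal.span {a} ↔ ∃ c, z - c * a ∈ 𝔟 := by
  rw [sup_comm, Ideal.mem_span_singleton_sup]
  constructor
  · rintro ⟨c, b, hb, rfl⟩
    exact ⟨c, by simpa using hb⟩
  · rintro ⟨c, hc⟩
    exact ⟨c, _, hc, by ring⟩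

section Specialization

variable {B : Type*} [CommRing B] {r : ℕ} {σ : B →+* B} {u a N : B} {f c : Fin r → B}
  {𝔟 : Ideal B}

theorem map_mem_of_mem_sup_span_singleton (hσu : σ u = 0) (hσ𝔟 : ∀ b ∈ 𝔟, σ b ∈ 𝔟) {z : B}
    (hz : z ∈ 𝔟 ⊔ Ideal.span {u}) : σ z ∈ 𝔟 := by
  obtain ⟨d, hd⟩ := mem_sup_span_singleton_iff.mp hz
  simpa [hσu] using hσ𝔟 _ hd

/-- Specializing along the retraction `σ` killing `u`: regularity of `u` modulo the colon ideal. -/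
theorem mul_mem_of_mul_mul_mem (hσu : σ u = 0) (hσ : ∀ b, ∃ d, b = σ b + d * u)
    (hσf : ∀ i, σ (f i) = f i) (hσ𝔟 : ∀ b ∈ 𝔟, σ b ∈ 𝔟) (ha : a = ∑ i, c i * f i)
    (hu : ∀ y, u * y ∈ 𝔟 → y ∈ 𝔟) (hN : ∀ i, N * f i ∈ 𝔟 ⊔ Ideal.span {a})
    (hNreg : ∀ y, N * y ∈ 𝔟 ⊔ Ideal.span {u} → y ∈ 𝔟 ⊔ Ideal.span {u})
    {Y : B} (hY : ∀ i, u * Y * f i ∈ 𝔟 ⊔ Ideal.span {a}) (i : Fin r) :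
    Y * f i ∈ 𝔟 ⊔ Ideal.span {a} := by
  choose t ht using fun i ↦ mem_sup_span_singleton_iff.mp (hN i)
  choose β hβ using fun i ↦ mem_sup_span_singleton_iff.mp (hY i)
  have h1 (k : Fin r) : σ (β i) * f k ∈ 𝔟 := by
    have : β i * f k ∈ 𝔟 ⊔ Ideal.span {u} := by
      refine hNreg _ (mem_sup_span_singleton_iff.mpr ⟨t k * Y * f i, ?_⟩)
      have := 𝔟.sub_mem (𝔟.mul_mem_left (β i) (ht k)) (𝔟.mul_mem_left (t k) (hβ i))
      convert this using 1
      ring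
    simpa [hσf] using map_mem_of_mem_sup_span_singleton hσu hσ𝔟 this
  have h2 : σ (β i) * a ∈ 𝔟 := by
    rw [ha, Finset.mul_sum]
    refine 𝔟.sum_mem fun k _ ↦ ?_
    convert 𝔟.mul_mem_left (c k) (h1 k) using 1
    ring
  obtain ⟨d, hd⟩ := hσ (β i)
  refine mem_sup_span_singleton_iff.mpr ⟨d, hu _ ?_⟩
  convert 𝔟.add_mem (hβ i) h2 using 1
  linear_combination a * hd

/-- Specializing along the retraction `σ` killing `u`: the colon ideal commutes with
specialization. -/
theorem exists_eq_add_mul_of_mul_mem (hσu : σ u = 0) (hσ : ∀ b, ∃ d, b = σ b + d * u)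
    (hσf : ∀ i, σ (f i) = f i) (hσ𝔟 : ∀ b ∈ 𝔟, σ b ∈ 𝔟) (ha : a = ∑ i, c i * f i)
    (hN : ∀ i, N * f i ∈ 𝔟 ⊔ Ideal.span {a})
    (hNreg : ∀ y, N * y ∈ 𝔟 ⊔ Ideal.span {u} → y ∈ 𝔟 ⊔ Ideal.span {u})
    {y : B} (hy : ∀ i, y * f i ∈ 𝔟 ⊔ Ideal.span {a} ⊔ Ideal.span {u}) :
    ∃ Y d, y = Y + d * u ∧ ∀ i, Y * f i ∈ 𝔟 ⊔ Ideal.span {a} := by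
  have hN' (i : Fin r) := mem_sup_span_singleton_iff.mp
    ((sup_le_sup_right le_sup_left _ : 𝔟 ⊔ Ideal.span {a} ≤ 𝔟 ⊔ Ideal.span {u} ⊔ Ideal.span {a})
      (hN i))
  have hy' (i : Fin r) := mem_sup_span_singleton_iff.mp (sup_right_comm 𝔟 _ (Ideal.span {u}) ▸ hy i)
  choose t ht using hN'
  choose b hb using hy'
  set 𝔠 := 𝔟 ⊔ Ideal.span {u} with h𝔠
  let π := Ideal.Quotient.mk 𝔠
  have hπ (z : B) : π z = 0 ↔ z ∈ 𝔠 := Ideal.Quotient.eq_zero_iff_mem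
  replace ht (i : Fin r) : π N * π (f i) = π (t i) * π a := by
    simpa [sub_eq_zero] using (hπ _).mpr (ht i)
  replace hb (i : Fin r) : π y * π (f i) = π (b i) * π a := by
    simpa [sub_eq_zero] using (hπ _).mpr (hb i)
  have hNπ (z : B) (hz : π N * π z = 0) : π z = 0 :=
    (hπ z).mpr (hNreg z ((hπ _).mp (by simpa using hz)))
  have h1 (i k : Fin r) : b k * f i - b i * f k ∈ 𝔠 := by
    refine (hπ _).mp (hNπ _ ?_)
    rw [← map_mul]
    apply hNπ
    simp only [map_mul, map_sub]
    linear_combination (π N * π (b k)) * ht i - (π N * π (b i)) * ht k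
      - π N * π (t i) * hb k + π N * π (t k) * hb i + π (t i) * π y * ht k - π (t k) * π y * ht i
  set w := y - ∑ k, b k * c k with hw
  have hwa : π w * π a = 0 := by
    have : π y * π a = (∑ k, π (b k) * π (c k)) * π a := by
      conv_lhs => rw [ha]
      simp only [map_sum, map_mul, Finset.mul_sum, Finset.sum_mul]
      refine Finset.sum_congr rfl fun k _ ↦ ?_
      linear_combination π (c k) * hb k
    rw [hw, map_sub, map_sum, sub_mul, this]
    simp
  have h2 (i : Fin r) : w * f i ∈ 𝔠 := by
    refine (hπ _).mp (hNπ _ ?_)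
    rw [map_mul]
    linear_combination π w * ht i + π (t i) * hwa
  have h1' (i k : Fin r) : σ (b k) * f i - σ (b i) * f k ∈ 𝔟 := by
    simpa [hσf] using map_mem_of_mem_sup_span_singleton hσu hσ𝔟 (h1 i k)
  have h2' (i : Fin r) : σ w * f i ∈ 𝔟 := by
    simpa [hσf] using map_mem_of_mem_sup_span_singleton hσu hσ𝔟 (h2 i)
  choose d hd using fun k ↦ hσ (b k)
  obtain ⟨e, he⟩ := hσ w
  refine ⟨∑ k, σ (b k) * c k + σ w, ∑ k, d k * c k + e, ?_, fun i ↦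
    mem_sup_span_singleton_iff.mpr ⟨σ (b i), ?_⟩⟩
  · have h3 : ∑ k, b k * c k = ∑ k, σ (b k) * c k + (∑ k, d k * c k) * u := by
      rw [Finset.sum_mul, ← Finset.sum_add_distrib]
      refine Finset.sum_congr rfl fun k _ ↦ ?_
      linear_combination c k * hd k
    linear_combination h3 + he - hw
  · have h4 : (∑ k, σ (b k) * c k + σ w) * f i - σ (b i) * a =
        ∑ k, c k * (σ (b k) * f i - σ (b i) * f k) + σ w * f i := by
      rw [ha, add_mul, Finset.sum_mul, Finset.mul_sum, add_sub_right_comm,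
        ← Finset.sum_sub_distrib]
      congr 1
      refine Finset.sum_congr rfl fun k _ ↦ ?_
      ring
    rw [h4]
    exact 𝔟.add_mem (𝔟.sum_mem fun k _ ↦ 𝔟.mul_mem_left _ (h1' i k)) (h2' i)

end Specialization

/-- Elements fixed by a ring endomorphism generate a stable ideal. -/
theorem map_mem_ofList {B : Type*} [CommRing B] {σ : B →+* B} {L : List B}
    (h : ∀ z ∈ L, σ z = z) {b : B} (hb : b ∈ Ideal.ofList L) : σ b ∈ Ideal.ofList L := by
  have : Ideal.ofList L ≤ (Ideal.ofList L).comap σ := by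
    refine Ideal.span_le.mpr fun z hz ↦ ?_
    have hz' : z ∈ L := hz
    simpa [h z hz'] using Ideal.subset_span hz
  exact this hb

theorem ofList_erase_map_sup_span_singleton {B ι : Type*} [CommRing B] [Fintype ι]
    [DecidableEq ι] (a : ι → B) (k : ι) :
    Ideal.ofList ((Finset.univ.erase k).toList.map a) ⊔ Ideal.span {a k} =
      Ideal.span (Set.range a) := by
  rw [← Ideal.ofList_singleton, ← Ideal.ofList_append]
  refine congrArg Ideal.span (Set.ext fun z ↦ ?_)
  simp only [List.mem_append, List.mem_map, Finset.mem_toList, Finset.mem_erase,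
    Finset.mem_univ, and_true, List.mem_singleton, Set.mem_ofPred_eq, Set.mem_range]
  constructor
  · rintro (⟨j, -, rfl⟩ | rfl) <;> exact ⟨_, rfl⟩
  · rintro ⟨j, rfl⟩
    by_cases hj : j = k
    · exact Or.inr (by rw [hj])
    · exact Or.inl ⟨j, hj, rfl⟩

/-- The specialization of a residual intersection along a sequence `x` of coefficients, each of
which can be killed by a retraction that fixes the other ones. -/
theorem isWeaklyRegular_quotient_colon {T : Type*} [CommRing T] [IsLocalRing T]
    [IsNoetherianRing T] {r s : ℕ} {f : Fin r → T} {x C : Fin r × Fin s → T} {a : Fin s → T}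
    (ha : ∀ j, a j = ∑ i, C (i, j) * f i) (σ : Fin r × Fin s → T →+* T)
    (hσx : ∀ p, σ p (x p) = 0) (hσne : ∀ p q, q ≠ p → σ p (x q) = x q)
    (hσ : ∀ p t, ∃ d, t = σ p t + d * x p) (hσf : ∀ p i, σ p (f i) = f i)
    (hσa : ∀ p j, j ≠ p.2 → σ p (a j) = a j)
    (hxm : ∀ p, x p ∈ IsLocalRing.maximalIdeal T) (ham : ∀ j, a j ∈ IsLocalRing.maximalIdeal T)
    (H : ∀ k, ∃ N ∈ IsLocalRing.maximalIdeal T, (∀ i, N * f i ∈ Ideal.span (Set.range a)) ∧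
      RingTheory.Sequence.IsWeaklyRegular T
        ((Finset.univ.toList.map x ++ (Finset.univ.erase k).toList.map a) ++ [N]))
    {K : Ideal T} (hK : ∀ y, y ∈ K ↔ ∀ i, y * f i ∈ Ideal.span (Set.range a))
    (l : List (Fin r × Fin s)) (hl : l.Nodup) :
    RingTheory.Sequence.IsWeaklyRegular (T ⧸ K) (l.map x) ∧
      ∀ y, (∀ i, y * f i ∈ Ideal.span (Set.range a) ⊔ Ideal.ofList (l.map x)) →
        y ∈ K ⊔ Ideal.ofList (l.map x) := by
  induction l using List.reverseRecOn with
  | nil => simp [hK]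
  | append_singleton l p ih =>
    obtain ⟨hl', -, hpl⟩ := List.nodup_append.mp hl
    have hpl' : ∀ q ∈ l, q ≠ p := fun q hq ↦ hpl q hq p (by simp)
    obtain ⟨ih1, ih2⟩ := ih hl'
    obtain ⟨N, hNm, hN, hreg⟩ := H p.2
    set A := (Finset.univ.erase p.2).toList.map a with hA
    obtain ⟨l', hl'p, hsub⟩ := List.subperm_of_subset hl
      (fun q _ ↦ Finset.mem_toList.mpr (Finset.mem_univ q))
    obtain ⟨rest, hrest⟩ := hsub.exists_perm_append
    replace hrest := hrest.trans (hl'p.append_right rest)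
    have hperm : ((Finset.univ.toList.map x ++ A) ++ [N]).Perm
        ((((A ++ l.map x) ++ [x p]) ++ [N]) ++ rest.map x) := by
      have h1 := hrest.map x
      simp only [List.map_append, List.map_cons, List.map_nil] at h1
      rw [← Multiset.coe_eq_coe] at h1 ⊢
      simp only [← Multiset.coe_add] at h1 ⊢
      rw [h1]
      abel
    have hreg' := IsLocalRing.isWeaklyRegular_of_perm_of_subset_maximalIdeal hreg hperm (by
      intro z hz
      simp only [hA, List.mem_append, List.mem_map, List.mem_singleton] at hz
      rcases hz with (⟨q, -, rfl⟩ | ⟨j, -, rfl⟩) | rfl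
      exacts [hxm q, ham j, hNm])
    rw [RingTheory.Sequence.isWeaklyRegular_append_iff, isWeaklyRegular_append_singleton_iff,
      isWeaklyRegular_append_singleton_iff] at hreg'
    obtain ⟨⟨⟨-, hu⟩, hNreg⟩, -⟩ := hreg'
    rw [Ideal.ofList_append, Ideal.ofList_singleton] at hNreg
    have h𝔟 : Ideal.ofList (A ++ l.map x) ⊔ Ideal.span {a p.2} =
        Ideal.span (Set.range a) ⊔ Ideal.ofList (l.map x) := by
      rw [Ideal.ofList_append, sup_right_comm, hA, ofList_erase_map_sup_span_singleton]
    have hσ𝔟 : ∀ b ∈ Ideal.ofList (A ++ l.map x), σ p b ∈ Ideal.ofList (A ++ l.map x) := by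
      refine fun b ↦ map_mem_ofList fun z hz ↦ ?_
      simp only [hA, List.mem_append, List.mem_map, Finset.mem_toList, Finset.mem_erase] at hz
      rcases hz with ⟨j, hj, rfl⟩ | ⟨q, hq, rfl⟩
      exacts [hσa p j hj.1, hσne p q (hpl' q hq)]
    have hN' (i : Fin r) : N * f i ∈ Ideal.ofList (A ++ l.map x) ⊔ Ideal.span {a p.2} :=
      h𝔟 ▸ Ideal.mem_sup_left (hN i)
    rw [List.map_append, List.map_cons, List.map_nil, isWeaklyRegular_quotient_append_singleton_iff]
    have hKl : ∀ y ∈ K ⊔ Ideal.ofList (l.map x), ∀ i,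
        y * f i ∈ Ideal.ofList (A ++ l.map x) ⊔ Ideal.span {a p.2} := by
      intro y hy i
      obtain ⟨k, hk, z, hz, rfl⟩ := Submodule.mem_sup.mp hy
      rw [h𝔟, add_mul]
      exact Ideal.add_mem _ (Ideal.mem_sup_left ((hK k).mp hk i))
        (Ideal.mem_sup_right (Ideal.mul_mem_right _ _ hz))
    refine ⟨⟨ih1, fun y hy ↦ ih2 y ?_⟩, fun y hy ↦ ?_⟩
    · rw [← h𝔟]
      exact mul_mem_of_mul_mul_mem (hσx p) (hσ p) (hσf p) hσ𝔟 (ha p.2) hu hN' hNreg (hKl _ hy)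
    · rw [Ideal.ofList_append, Ideal.ofList_singleton, ← sup_assoc, ← h𝔟] at hy
      obtain ⟨Y, d, rfl, hY⟩ := exists_eq_add_mul_of_mul_mem (hσx p) (hσ p) (hσf p) hσ𝔟 (ha p.2)
        hN' hNreg hy
      rw [h𝔟] at hY
      rw [Ideal.ofList_append, Ideal.ofList_singleton, ← sup_assoc]
      exact Ideal.add_mem _ (Ideal.mem_sup_left (ih2 Y hY))
        (Ideal.mem_sup_right (Ideal.mul_mem_left _ _ (Ideal.mem_span_singleton_self _)))

theorem isWeaklyRegular_append_of_ker_eq {R T : Type*} [CommRing R] [CommRing T] {π : T →+* R}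
    (hπ : Function.Surjective π) {X L : List T} (hker : RingHom.ker π = Ideal.ofList X)
    (hX : RingTheory.Sequence.IsWeaklyRegular T X)
    (hL : RingTheory.Sequence.IsWeaklyRegular R (L.map π)) :
    RingTheory.Sequence.IsWeaklyRegular T (X ++ L) := by
  rw [RingTheory.Sequence.isWeaklyRegular_append_iff]
  refine ⟨hX, ?_⟩
  have h : (Ideal.ofList X • ⊤ : Submodule T T) = RingHom.ker π := by
    rw [hker]
    simp
  let e : (T ⧸ (Ideal.ofList X • ⊤ : Submodule T T)) ≃+ R :=
    (Submodule.quotEquivOfEq _ _ h).toAddEquiv.trans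
      (RingHom.quotientKerEquivOfSurjective hπ).toAddEquiv
  refine (AddEquiv.isWeaklyRegular_congr (e := e) ?_).mpr hL
  rw [List.forall₂_map_right_iff, List.forall₂_same]
  intro z _ y
  obtain ⟨y, rfl⟩ := Submodule.Quotient.mk_surjective _ y
  exact map_mul π z y

/-- A regular sequence `x` in a local `R`-algebra `T` that generates the kernel of a retraction
`π` onto `R` and whose members can be moved independently by endomorphisms of `T`. -/
structure IsRegularCoordinateSystem {R T ι : Type*} [CommRing R] [CommRing T] [IsLocalRing T]
    [Algebra R T] [Fintype ι] (π : T →ₐ[R] R) (x : ι → T) : Prop where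
  ker_eq : RingHom.ker π = Ideal.span (Set.range x)
  isWeaklyRegular : RingTheory.Sequence.IsWeaklyRegular T (Finset.univ.toList.map x)
  exists_algHom (y : ι → T) (hy : ∀ p, y p ∈ IsLocalRing.maximalIdeal T) :
    ∃ τ : T →ₐ[R] T, (∀ p, τ (x p) = y p) ∧ ∀ t, τ t - t ∈ Ideal.span (Set.range (y - x))

theorem ofList_univ_map {T ι : Type*} [CommRing T] [Fintype ι] (x : ι → T) :
    Ideal.ofList (Finset.univ.toList.map x) = Ideal.span (Set.range x) :=
  congrArg Ideal.span (by ext; simp)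

namespace IsRegularCoordinateSystem

variable {R T ι : Type*} [CommRing R] [CommRing T] [IsLocalRing T] [Algebra R T]
  [Fintype ι] {π : T →ₐ[R] R} {x : ι → T}

theorem map_eq_zero (hx : IsRegularCoordinateSystem π x) (p : ι) : π (x p) = 0 :=
  (hx.ker_eq ▸ Ideal.subset_span ⟨p, rfl⟩ : x p ∈ RingHom.ker π)

theorem mem_maximalIdeal_of_map_mem [IsLocalRing R] {t : T}
    (ht : π t ∈ IsLocalRing.maximalIdeal R) : t ∈ IsLocalRing.maximalIdeal T :=
  fun h ↦ ht (h.map π)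

theorem exists_retraction [DecidableEq ι] (hx : IsRegularCoordinateSystem π x)
    (hxm : ∀ p, x p ∈ IsLocalRing.maximalIdeal T) (p : ι) :
    ∃ σ : T →ₐ[R] T, σ (x p) = 0 ∧ (∀ q, q ≠ p → σ (x q) = x q) ∧ ∀ t, ∃ d, t = σ t + d * x p := by
  obtain ⟨σ, hσ, hσt⟩ := hx.exists_algHom (Function.update x p 0) (fun q ↦ by
    by_cases hq : q = p
    · subst hq
      simp
    · simpa [hq] using hxm q)
  refine ⟨σ, by simp [hσ], fun q hq ↦ by simp [hσ, hq], fun t ↦ ?_⟩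
  have hle : Ideal.span (Set.range (Function.update x p 0 - x)) ≤ Ideal.span {x p} := by
    rw [Ideal.span_le]
    rintro - ⟨q, rfl⟩
    by_cases hq : q = p
    · subst hq
      simp
    · simp [hq]
  obtain ⟨d, hd⟩ := Ideal.mem_span_singleton'.mp (hle (hσt t))
  exact ⟨-d, by linear_combination hd⟩

end IsRegularCoordinateSystem

/-- A multiplier of `f₁, …, f_r` into `(a₁, …, a_s)` lifts, up to a power, along a change of the
coefficients of the `aⱼ`. -/
theorem exists_lift_multiplier {R T : Type*} [CommRing R] [CommRing T] [Algebra R T]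
    (π : T →ₐ[R] R) {r s : ℕ} {f : Fin r → R} {a : Fin s → R} {x : Fin r × Fin s → T}
    (hx : ∀ p, π (x p) = 0) {N : R} (hN : ∀ i, N * f i ∈ Ideal.span (Set.range a)) :
    ∃ M : T, π M = N ^ r ∧ ∀ i, M * algebraMap R T (f i) ∈
      Ideal.span (Set.range fun j ↦
        algebraMap R T (a j) + ∑ i, x (i, j) * algebraMap R T (f i)) := by
  choose t ht using fun i ↦ Ideal.mem_span_range_iff_exists_fun.mp (hN i)
  let A : Matrix (Fin r) (Fin r) T := Matrix.of fun i k ↦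
    (if i = k then algebraMap R T N else 0) + ∑ j, algebraMap R T (t i j) * x (k, j)
  have hA : π.toRingHom.mapMatrix A = Matrix.diagonal fun _ ↦ N := by
    ext i k
    simp [A, hx, Matrix.diagonal_apply, apply_ite π]
  refine ⟨A.det, ?_, fun i ↦ ?_⟩
  · have := RingHom.map_det π.toRingHom A
    rw [hA, Matrix.det_diagonal] at this
    simpa using this
  have hAf (l : Fin r) : (A.mulVec fun i ↦ algebraMap R T (f i)) l = ∑ j, algebraMap R T (t l j) *
      (algebraMap R T (a j) + ∑ i, x (i, j) * algebraMap R T (f i)) := by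
    have h1 := congrArg (algebraMap R T) (ht l)
    simp only [map_sum, map_mul] at h1
    simp only [Matrix.mulVec, dotProduct, A, Matrix.of_apply, add_mul, mul_add,
      Finset.sum_add_distrib, h1]
    congr 1
    · simp
    · simp_rw [Finset.sum_mul, Finset.mul_sum]
      rw [Finset.sum_comm]
      simp only [mul_assoc]
  have h2 : A.det * algebraMap R T (f i) =
      ∑ l, A.adjugate i l * (A.mulVec fun i ↦ algebraMap R T (f i)) l := by
    have := congrFun (congrArg (Matrix.mulVec · fun i ↦ algebraMap R T (f i)) A.adjugate_mul) i
    simp only [← Matrix.mulVec_mulVec, Matrix.smul_mulVec, Matrix.one_mulVec] at this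
    exact this.symm
  rw [h2]
  refine Ideal.sum_mem _ fun l _ ↦ Ideal.mul_mem_left _ _ ?_
  rw [hAf]
  exact Ideal.sum_mem _ fun j _ ↦ Ideal.mul_mem_left _ _ (Ideal.subset_span ⟨j, rfl⟩)

/-- Residual intersections deform along a regular coordinate system, if the given generators
can be completed to suitable regular sequences. -/
theorem IsRegularCoordinateSystem.colon_of_exists_isWeaklyRegular {R T : Type*} [CommRing R]
    [IsLocalRing R] [CommRing T] [IsLocalRing T] [IsNoetherianRing T] [Algebra R T]
    {π : T →ₐ[R] R} {r s : ℕ}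
    {x : Fin r × Fin s → T} (hx : IsRegularCoordinateSystem π x) {f : Fin r → R}
    {c : Fin r × Fin s → R} {a : Fin s → R} (ha : ∀ j, a j = ∑ i, c (i, j) * f i) {J : Ideal R}
    (hJ : ∀ y, y ∈ J ↔ ∀ i, y * f i ∈ Ideal.span (Set.range a)) (hJ_ne : J ≠ ⊤)
    (H : ∀ k, ∃ N ∈ J, RingTheory.Sequence.IsWeaklyRegular R
      ((Finset.univ.erase k).toList.map a ++ [N]))
    {K : Ideal T} (hK : ∀ y, y ∈ K ↔ ∀ i, y * algebraMap R T (f i) ∈ Ideal.span (Set.range fun j ↦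
        algebraMap R T (a j) + ∑ i, x (i, j) * algebraMap R T (f i))) :
    RingTheory.Sequence.IsWeaklyRegular (T ⧸ K) (Finset.univ.toList.map x) ∧
      K ⊔ Ideal.span (Set.range x) = J.comap π := by
  have hxm (p) : x p ∈ IsLocalRing.maximalIdeal T :=
    mem_maximalIdeal_of_map_mem (π := π) (by simp [hx.map_eq_zero])
  choose σ hσx hσne hσ using hx.exists_retraction hxm
  have hπ : Function.Surjective π := fun y ↦ ⟨algebraMap R T y, by simp⟩
  have haJ (j) : a j ∈ IsLocalRing.maximalIdeal R :=
    IsLocalRing.le_maximalIdeal hJ_ne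
      ((hJ _).mpr fun i ↦ Ideal.mul_mem_right _ _ (Ideal.subset_span ⟨j, rfl⟩))
  have hr : r ≠ 0 := by
    rintro rfl
    exact hJ_ne (Ideal.eq_top_iff_one _ |>.mpr ((hJ 1).mpr fun i ↦ i.elim0))
  set a' : Fin s → T := fun j ↦
    algebraMap R T (a j) + ∑ i, x (i, j) * algebraMap R T (f i) with ha'
  have hπa (j) : π (a' j) = a j := by simp [ha', hx.map_eq_zero]
  have hmain := isWeaklyRegular_quotient_colon (f := fun i ↦ algebraMap R T (f i)) (x := x)
    (C := fun p ↦ algebraMap R T (c p) + x p) (a := a')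
    (fun j ↦ by simp [ha', ha, add_mul, Finset.sum_add_distrib])
    (fun p ↦ (σ p).toRingHom) hσx hσne hσ (by simp) (fun p j hj ↦ by
      have (i : Fin r) : σ p (x (i, j)) = x (i, j) := hσne p _ (by rintro rfl; exact hj rfl)
      simp [ha', this]) hxm
    (fun j ↦ mem_maximalIdeal_of_map_mem (π := π) (by simpa [hπa] using haJ j)) (fun k ↦ by
      obtain ⟨N, hN, hreg⟩ := H k
      obtain ⟨M, hM, hMf⟩ := exists_lift_multiplier π (fun p ↦ hx.map_eq_zero p) ((hJ N).mp hN)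
      refine ⟨M, mem_maximalIdeal_of_map_mem (π := π) ?_, hMf, ?_⟩
      · rw [hM]
        exact Ideal.pow_mem_of_mem _ (IsLocalRing.le_maximalIdeal hJ_ne hN) _ hr.bot_lt
      · rw [List.append_assoc]
        refine isWeaklyRegular_append_of_ker_eq (π := π.toRingHom) hπ
          (by rw [ofList_univ_map]; exact hx.ker_eq) hx.isWeaklyRegular ?_
        rw [RingTheory.Sequence.isWeaklyRegular_append_iff,
          RingTheory.Sequence.isWeaklyRegular_singleton_iff] at hreg
        have hl : ((Finset.univ.erase k).toList.map a' ++ [M]).map π.toRingHom =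
            (Finset.univ.erase k).toList.map a ++ [N ^ r] := by
          simp [Function.comp_def, hπa, hM]
        rw [hl, RingTheory.Sequence.isWeaklyRegular_append_iff,
          RingTheory.Sequence.isWeaklyRegular_singleton_iff]
        exact ⟨hreg.1, hreg.2.pow r⟩)
    hK Finset.univ.toList (Finset.nodup_toList _)
  rw [ofList_univ_map] at hmain
  refine ⟨hmain.1, le_antisymm (sup_le (fun y hy ↦ ?_) ?_) fun y hy ↦ hmain.2 y fun i ↦ ?_⟩
  · refine (hJ _).mpr fun i ↦ ?_
    have h1 := Ideal.mem_map_of_mem π ((hK y).mp hy i)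
    rw [Ideal.map_span, ← Set.range_comp] at h1
    simpa [Function.comp_def, hπa] using h1
  · rw [← hx.ker_eq]
    exact Ideal.comap_mono bot_le
  · obtain ⟨t, ht⟩ := Ideal.mem_span_range_iff_exists_fun.mp ((hJ _).mp hy i)
    have h1 : y * algebraMap R T (f i) - ∑ j, algebraMap R T (t j) * a' j ∈
        Ideal.span (Set.range x) := by
      rw [← hx.ker_eq, RingHom.mem_ker]
      simp [hπa, ht]
    rw [← add_sub_cancel (∑ j, algebraMap R T (t j) * a' j) (y * algebraMap R T (f i))]
    exact Ideal.add_mem _ (Ideal.mem_sup_left (Ideal.sum_mem _ fun j _ ↦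
      Ideal.mul_mem_left _ _ (Ideal.subset_span ⟨j, rfl⟩))) (Ideal.mem_sup_right h1)

theorem isWeaklyRegular_of_sub_mem_span {T M ι : Type*} [CommRing T] [IsLocalRing T]
    [AddCommGroup M] [Module T M] [IsNoetherian T M] [Fintype ι] [DecidableEq ι] {x y : ι → T}
    (hx : ∀ p, x p ∈ IsLocalRing.maximalIdeal T) (hy : ∀ p, y p ∈ IsLocalRing.maximalIdeal T)
    (S : Finset ι) (hS : ∀ p ∈ S, y p = x p) (hSc : ∀ p ∉ S, y p - x p ∈ Ideal.span (x '' S))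
    (hreg : RingTheory.Sequence.IsWeaklyRegular M (Finset.univ.toList.map x)) :
    RingTheory.Sequence.IsWeaklyRegular M (Finset.univ.toList.map y) := by
  have hperm : (Finset.univ : Finset ι).toList.Perm (S.toList ++ Sᶜ.toList) := by
    refine (List.perm_ext_iff_of_nodup (Finset.nodup_toList _) ?_).mpr fun p ↦ ?_
    · refine List.nodup_append.mpr ⟨Finset.nodup_toList _, Finset.nodup_toList _, ?_⟩
      rintro p hp q hq rfl
      exact Finset.mem_compl.mp (Finset.mem_toList.mp hq) (Finset.mem_toList.mp hp)
    · simp [em]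
  have h1 := IsLocalRing.isWeaklyRegular_of_perm_of_subset_maximalIdeal hreg (hperm.map x)
    (by simpa using hx)
  refine IsLocalRing.isWeaklyRegular_of_perm_of_subset_maximalIdeal ?_ (hperm.map y).symm
    (fun z hz ↦ ?_)
  swap
  · obtain ⟨p, -, rfl⟩ := List.mem_map.mp hz
    exact hy p
  have hSy : S.toList.map y = S.toList.map x :=
    List.map_congr_left fun p hp ↦ hS p (Finset.mem_toList.mp hp)
  have hspan : Ideal.ofList (S.toList.map x) = Ideal.span (x '' S) :=
    congrArg Ideal.span (by ext; simp)
  rw [List.map_append, RingTheory.Sequence.isWeaklyRegular_append_iff'] at h1 ⊢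
  rw [hSy]
  refine ⟨h1.1, ?_⟩
  convert h1.2 using 1
  simp only [List.map_map]
  refine List.map_congr_left fun p hp ↦ ?_
  rw [Function.comp_apply, Function.comp_apply, Ideal.Quotient.mk_eq_mk_iff_sub_mem, hspan]
  exact hSc p (by simpa using hp)

section shear

variable {R M ι : Type*} [CommRing R] [AddCommGroup M] [Module R M] [Fintype ι] [DecidableEq ι]
  {t : ι} {l : ι → R}

/-- Add the linear combination of the entries of `v` with coefficients `l` to the entry `v t`. -/
def shear (t : ι) (l : ι → R) (v : ι → M) : ι → M :=
  Function.update v t (v t + ∑ k, l k • v k)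

theorem shear_apply_self (v : ι → M) : shear t l v t = v t + ∑ k, l k • v k := by simp [shear]

theorem shear_apply_of_ne {k : ι} (hk : k ≠ t) (v : ι → M) : shear t l v k = v k := by
  simp [shear, hk]

theorem shear_add (v w : ι → M) : shear t l (v + w) = shear t l v + shear t l w := by
  ext k
  by_cases hk : k = t
  · subst hk
    simp only [shear_apply_self, Pi.add_apply, smul_add, Finset.sum_add_distrib]
    abel
  · simp [shear_apply_of_ne hk]

theorem shear_sub (v w : ι → M) : shear t l (v - w) = shear t l v - shear t l w :=
  eq_sub_of_add_eq (by rw [← shear_add, sub_add_cancel])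

theorem map_shear {M' F : Type*} [AddCommGroup M'] [Module R M'] [FunLike F M M']
    [LinearMapClass F R M M'] (φ : F) (v : ι → M) (k : ι) :
    φ (shear t l v k) = shear t l (fun k ↦ φ (v k)) k := by
  by_cases hk : k = t
  · subst hk
    simp [shear_apply_self]
  · simp [shear_apply_of_ne hk]

theorem shear_shear_neg (hl : l t = 0) (v : ι → M) : shear t (-l) (shear t l v) = v := by
  have h : ∑ k, l k • shear t l v k = ∑ k, l k • v k := by
    refine Finset.sum_congr rfl fun k _ ↦ ?_
    by_cases hk : k = t
    · subst hk
      simp [hl]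
    · rw [shear_apply_of_ne hk]
  ext k
  by_cases hk : k = t
  · subst hk
    rw [shear_apply_self]
    simp [h, shear_apply_self]
  · simp [shear_apply_of_ne hk]

end shear

section shearIdeal

variable {R T ι κ : Type*} [CommRing R] [CommRing T] [Algebra R T] [Fintype ι] [DecidableEq ι]
  {t : ι} {l : ι → R}

theorem shear_mem {I : Ideal T} {v : ι → T} (hv : ∀ k, v k ∈ I) (k : ι) : shear t l v k ∈ I := by
  by_cases hk : k = t
  · subst hk
    rw [shear_apply_self]
    exact I.add_mem (hv k) (I.sum_mem fun j _ ↦ Submodule.smul_of_tower_mem I _ (hv j))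
  · rw [shear_apply_of_ne hk]
    exact hv k

theorem span_range_shear (hl : l t = 0) (v : ι → T) :
    Ideal.span (Set.range (shear t l v)) = Ideal.span (Set.range v) := by
  refine le_antisymm (Ideal.span_le.mpr ?_) (Ideal.span_le.mpr ?_)
  · rintro - ⟨k, rfl⟩
    exact shear_mem (fun j ↦ Ideal.subset_span (Set.mem_range_self j)) k
  · rintro - ⟨k, rfl⟩
    have := shear_mem (t := t) (l := -l) (v := shear t l v)
      (fun j ↦ Ideal.subset_span (Set.mem_range_self j)) k
    rwa [shear_shear_neg hl] at this

/-- The operation `shear` applied to each row of a matrix. -/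
def rowShear (t : ι) (l : ι → R) (x : κ × ι → T) : κ × ι → T :=
  fun p ↦ shear t l (fun k ↦ x (p.1, k)) p.2

theorem rowShear_rowShear_neg (hl : l t = 0) (x : κ × ι → T) :
    rowShear t (-l) (rowShear t l x) = x :=
  funext fun p ↦ congrFun (shear_shear_neg hl fun k ↦ x (p.1, k)) p.2

theorem rowShear_sub (x y : κ × ι → T) :
    rowShear t l (x - y) = rowShear t l x - rowShear t l y :=
  funext fun p ↦ congrFun (shear_sub (fun k ↦ x (p.1, k)) fun k ↦ y (p.1, k)) p.2

theorem rowShear_mem {I : Ideal T} {x : κ × ι → T} (hx : ∀ p, x p ∈ I) (p : κ × ι) :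
    rowShear t l x p ∈ I :=
  shear_mem (fun _ ↦ hx _) _

theorem span_range_rowShear (hl : l t = 0) (x : κ × ι → T) :
    Ideal.span (Set.range (rowShear t l x)) = Ideal.span (Set.range x) := by
  refine le_antisymm (Ideal.span_le.mpr ?_) (Ideal.span_le.mpr ?_)
  · rintro - ⟨p, rfl⟩
    exact rowShear_mem (fun q ↦ Ideal.subset_span (Set.mem_range_self q)) p
  · rintro - ⟨p, rfl⟩
    have := rowShear_mem (t := t) (l := -l) (x := rowShear t l x)
      (fun q ↦ Ideal.subset_span (Set.mem_range_self q)) p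
    rwa [rowShear_rowShear_neg hl] at this

theorem sum_rowShear_mul [Fintype κ] (x : κ × ι → T) (g : κ → T) (j : ι) :
    ∑ i, rowShear t l x (i, j) * g i = shear t l (fun j ↦ ∑ i, x (i, j) * g i) j := by
  by_cases hj : j = t
  · subst hj
    simp only [rowShear, shear_apply_self, add_mul, Finset.sum_add_distrib, Finset.sum_mul,
      Finset.smul_sum, smul_mul_assoc]
    rw [Finset.sum_comm]
  · simp [rowShear, shear_apply_of_ne hj]

theorem isWeaklyRegular_rowShear {M : Type*} [Fintype κ] [DecidableEq κ] [IsLocalRing T]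
    [AddCommGroup M] [Module T M] [IsNoetherian T M] {x : κ × ι → T}
    (hx : ∀ p, x p ∈ IsLocalRing.maximalIdeal T) (hl : l t = 0)
    (hreg : RingTheory.Sequence.IsWeaklyRegular M (Finset.univ.toList.map x)) :
    RingTheory.Sequence.IsWeaklyRegular M (Finset.univ.toList.map (rowShear t l x)) := by
  refine isWeaklyRegular_of_sub_mem_span hx (rowShear_mem hx)
    (Finset.univ.filter fun p : κ × ι ↦ p.2 ≠ t) (fun p hp ↦ ?_) (fun p hp ↦ ?_) hreg
  · exact shear_apply_of_ne (by simpa using hp) _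
  · obtain rfl : p.2 = t := by simpa using hp
    rw [rowShear, shear_apply_self, add_sub_cancel_left]
    refine Ideal.sum_mem _ fun k _ ↦ ?_
    by_cases hk : k = p.2
    · simp [hk, hl]
    · exact Submodule.smul_of_tower_mem _ _ (Ideal.subset_span ⟨(p.1, k), by simpa using hk, rfl⟩)

theorem IsRegularCoordinateSystem.rowShear [Fintype κ] [DecidableEq κ] [IsLocalRing T]
    [IsNoetherianRing T] {π : T →ₐ[R] R} {x : κ × ι → T} (hx : IsRegularCoordinateSystem π x)
    (hxm : ∀ p, x p ∈ IsLocalRing.maximalIdeal T) (hl : l t = 0) :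
    IsRegularCoordinateSystem π (rowShear t l x) where
  ker_eq := by rw [span_range_rowShear hl, hx.ker_eq]
  isWeaklyRegular := isWeaklyRegular_rowShear hxm hl hx.isWeaklyRegular
  exists_algHom y hy := by
    obtain ⟨τ, hτ, hτt⟩ := hx.exists_algHom (_root_.rowShear t (-l) y) (rowShear_mem hy)
    have hy' : _root_.rowShear t l (_root_.rowShear t (-l) y) = y := by
      simpa using rowShear_rowShear_neg (l := -l) (by simpa using hl) y
    refine ⟨τ, fun p ↦ ?_, fun z ↦ ?_⟩
    · rw [← congrFun hy' p]
      simp only [_root_.rowShear, map_shear, hτ]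
    · rw [← hy', ← rowShear_sub, span_range_rowShear hl]
      exact hτt z

end shearIdeal

theorem mem_colon_span_range_iff {B κ : Type*} [CommRing B] [Fintype κ] {𝔟 : Ideal B} {g : κ → B}
    {y : B} : y ∈ 𝔟.colon (Ideal.span (Set.range g) : Set B) ↔ ∀ i, y * g i ∈ 𝔟 := by
  refine Submodule.mem_colon.trans ⟨fun h i ↦ h _ (Ideal.subset_span ⟨i, rfl⟩), fun h z hz ↦ ?_⟩
  obtain ⟨t, rfl⟩ := Ideal.mem_span_range_iff_exists_fun.mp hz
  rw [smul_eq_mul, Finset.mul_sum]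
  refine 𝔟.sum_mem fun i _ ↦ ?_
  convert 𝔟.mul_mem_left (t i) (h i) using 1
  ring

theorem IsCohenMacaulayLocalRing.isWeaklyRegular_quotient_colon {R T : Type*} [CommRing R]
    [IsNoetherianRing R] [IsLocalRing R] (hCM : IsCohenMacaulayLocalRing R)
    [CommRing T] [IsLocalRing T] [IsNoetherianRing T] [Algebra R T] {π : T →ₐ[R] R} {r s : ℕ}
    {x : Fin r × Fin s → T} (hx : IsRegularCoordinateSystem π x) {f : Fin r → R}
    {c : Fin r × Fin s → R} {𝔞 I : Ideal R} (hI_eq : I = Ideal.span (Set.range f))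
    (h𝔞 : 𝔞 = Ideal.span (Set.range fun j ↦ ∑ i, c (i, j) * f i))
    (hproper : 𝔞.colon (I : Set R) ≠ ⊤)
    (hJ : (s : ℕ∞) ≤ idealHeight (𝔞.colon (I : Set R))) (hI : (s : ℕ∞) ≤ idealHeight I + 1)
    {K : Ideal T} (hK : ∀ y, y ∈ K ↔ ∀ i, y * algebraMap R T (f i) ∈ Ideal.span (Set.range fun j ↦
        ∑ i, (algebraMap R T (c (i, j)) + x (i, j)) * algebraMap R T (f i))) :
    RingTheory.Sequence.IsWeaklyRegular (T ⧸ K) (Finset.univ.toList.map x) ∧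
      K ⊔ Ideal.span (Set.range x) = (𝔞.colon (I : Set R)).comap π := by
  have hcolon (y : R) : y ∈ 𝔞.colon (I : Set R) ↔ ∀ i, y * f i ∈ 𝔞 := by
    rw [hI_eq]
    exact mem_colon_span_range_iff
  let P (b : Fin s → R) : Prop := ∃ (x' : Fin r × Fin s → T) (c' : Fin r × Fin s → R),
    IsRegularCoordinateSystem π x' ∧ Ideal.span (Set.range x') = Ideal.span (Set.range x) ∧
    (∀ j, b j = ∑ i, c' (i, j) * f i) ∧ Ideal.span (Set.range b) = 𝔞 ∧
    Ideal.span (Set.range fun j ↦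
      algebraMap R T (b j) + ∑ i, x' (i, j) * algebraMap R T (f i)) =
      Ideal.span (Set.range fun j ↦
        ∑ i, (algebraMap R T (c (i, j)) + x (i, j)) * algebraMap R T (f i)) ∧
    (RingTheory.Sequence.IsWeaklyRegular (T ⧸ K) (Finset.univ.toList.map x') →
      RingTheory.Sequence.IsWeaklyRegular (T ⧸ K) (Finset.univ.toList.map x))
  obtain ⟨b, ⟨x', c', hx', hspan, hb, hb𝔞, hab, himp⟩, hreg⟩ :=
    hCM.exists_residual_generators hproper hJ hI P (fun b hb ↦ hb.choose_spec.choose_spec.2.2.2.1)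
    (by
      rintro b t l ⟨x', c', hx', hspan, hb, hb𝔞, hab, himp⟩ hl
      change P (shear t l b)
      have hxm (p) : x' p ∈ IsLocalRing.maximalIdeal T :=
        IsRegularCoordinateSystem.mem_maximalIdeal_of_map_mem (π := π) (by simp [hx'.map_eq_zero])
      refine ⟨rowShear t l x', rowShear t l c', hx'.rowShear hxm hl,
        (span_range_rowShear hl x').trans hspan, fun j ↦ ?_, (span_range_shear hl b).trans hb𝔞,
        ?_, fun h ↦ himp ?_⟩
      · rw [sum_rowShear_mul, ← funext hb]
      · rw [← hab]
        refine Eq.trans ?_ (span_range_shear (t := t) hl _)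
        refine congrArg (fun v ↦ Ideal.span (Set.range v)) (funext fun j ↦ ?_)
        rw [sum_rowShear_mul, ← Algebra.linearMap_apply, map_shear, ← Pi.add_apply, ← shear_add]
        rfl
      · have := isWeaklyRegular_rowShear (l := -l) (rowShear_mem hxm) (by simpa using hl) h
        rwa [rowShear_rowShear_neg hl] at this)
    (fun j ↦ ∑ i, c (i, j) * f i)
    ⟨x, c, hx, rfl, fun _ ↦ rfl, h𝔞.symm, by simp [add_mul, Finset.sum_add_distrib], id⟩
  have := hx'.colon_of_exists_isWeaklyRegular hb (J := 𝔞.colon (I : Set R))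
    (by simpa only [hb𝔞] using hcolon) hproper hreg (K := K) (by simpa only [hab] using hK)
  exact ⟨himp this.1, hspan ▸ this.2⟩

theorem ringHom_sub_mem_of_mvPolynomial {R B ι : Type*} [CommRing R] [CommRing B] {I : Ideal B}
    {φ ψ : MvPolynomial ι R →+* B} (hC : ∀ z, φ (C z) = ψ (C z))
    (hX : ∀ p, φ (X p) - ψ (X p) ∈ I) (t : MvPolynomial ι R) : φ t - ψ t ∈ I := by
  have : (Ideal.Quotient.mk I).comp φ = (Ideal.Quotient.mk I).comp ψ :=
    MvPolynomial.ringHom_ext (fun z ↦ by simp [hC])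
      fun p ↦ (Ideal.Quotient.mk_eq_mk_iff_sub_mem _ _).mpr (hX p)
  exact (Ideal.Quotient.mk_eq_mk_iff_sub_mem _ _).mp (RingHom.congr_fun this t)

theorem ringHom_sub_mem_of_isLocalization {S T B : Type*} [CommRing S] [CommRing T] [CommRing B]
    [Algebra S T] (M : Submonoid S) [IsLocalization M T] {I : Ideal B} {φ ψ : T →+* B}
    (h : ∀ z, φ (algebraMap S T z) - ψ (algebraMap S T z) ∈ I) (t : T) : φ t - ψ t ∈ I := by
  have : (Ideal.Quotient.mk I).comp φ = (Ideal.Quotient.mk I).comp ψ :=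
    IsLocalization.ringHom_ext M <| RingHom.ext fun z ↦
      (Ideal.Quotient.mk_eq_mk_iff_sub_mem _ _).mpr (h z)
  exact (Ideal.Quotient.mk_eq_mk_iff_sub_mem _ _).mp (RingHom.congr_fun this t)

theorem isWeaklyRegular_map_X_sub_C {R ι : Type*} [CommRing R] (c : ι → R) (l : List ι)
    (hl : l.Nodup) : RingTheory.Sequence.IsWeaklyRegular (MvPolynomial ι R)
      (l.map fun p ↦ (X p - C (c p) : MvPolynomial ι R)) := by
  classical
  induction l using List.reverseRecOn with
  | nil => simp
  | append_singleton l p ih =>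
    obtain ⟨hl', -, hpl⟩ := List.nodup_append.mp hl
    have hp : p ∉ l := fun h ↦ hpl p h p (by simp) rfl
    rw [List.map_append, List.map_cons, List.map_nil, isWeaklyRegular_append_singleton_iff]
    refine ⟨ih hl', fun g hg ↦ ?_⟩
    let φ : MvPolynomial ι R →ₐ[R] MvPolynomial ι R :=
      aeval fun q ↦ if q ∈ l then C (c q) else X q + C (c q)
    let ψ : MvPolynomial ι R →ₐ[R] MvPolynomial ι R := aeval fun q ↦ X q - C (c q)
    have hφ : Ideal.ofList (l.map fun p ↦ (X p - C (c p) : MvPolynomial ι R)) ≤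
        RingHom.ker φ := by
      refine Ideal.span_le.mpr fun z hz ↦ ?_
      obtain ⟨q, hq, rfl⟩ := List.mem_map.mp hz
      simp [φ, hq, ← MvPolynomial.algebraMap_eq]
    have h1 : X p * φ g = 0 := by
      simpa [φ, hp, ← MvPolynomial.algebraMap_eq] using hφ hg
    have h2 : φ g = 0 := by simpa using h1
    have h3 := ringHom_sub_mem_of_mvPolynomial (φ := RingHom.id _)
      (ψ := (ψ.comp φ : MvPolynomial ι R →ₐ[R] MvPolynomial ι R).toRingHom)
      (I := Ideal.ofList (l.map fun p ↦ (X p - C (c p) : MvPolynomial ι R)))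
      (by simp [φ, ψ, ← MvPolynomial.algebraMap_eq]) (fun q ↦ by
        by_cases hq : q ∈ l
        · have : (X q - C (c q) : MvPolynomial ι R) ∈ Ideal.ofList (l.map fun p ↦ X p - C (c p)) :=
            Ideal.subset_span (List.mem_map.mpr ⟨q, hq, rfl⟩)
          simpa [φ, ψ, hq, ← MvPolynomial.algebraMap_eq] using this
        · simp [φ, ψ, hq, ← MvPolynomial.algebraMap_eq]) g
    simpa [h2] using h3

section Localization

variable {R ι : Type*} [CommRing R] [IsLocalRing R] {c : ι → R} {𝔫 : Ideal (MvPolynomial ι R)}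
  [h𝔫 : 𝔫.IsMaximal]

theorem isUnit_aeval_of_notMem (h : ∀ p, X p - C (c p) ∈ 𝔫) {z : MvPolynomial ι R} (hz : z ∉ 𝔫) :
    IsUnit (aeval c z) := by
  have hsub (g : MvPolynomial ι R) : g - C (aeval c g) ∈ 𝔫 :=
    ringHom_sub_mem_of_mvPolynomial (φ := RingHom.id _) (ψ := C.comp (aeval c).toRingHom)
      (by simp) (by simpa using h) g
  have hle : 𝔫 ≤ (IsLocalRing.maximalIdeal R).comap (aeval c : MvPolynomial ι R →ₐ[R] R) := by
    intro g hg hunit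
    have hC : C (aeval c g) ∈ 𝔫 := by simpa using 𝔫.sub_mem hg (hsub g)
    exact h𝔫.ne_top (Ideal.eq_top_of_isUnit_mem _ hC (hunit.map C))
  have heq := h𝔫.eq_of_le (Ideal.comap_ne_top _ (Ideal.IsPrime.ne_top inferInstance)) hle
  rw [heq] at hz
  simpa using hz

theorem exists_isRegularCoordinateSystem [Fintype ι] (T : Type*) [CommRing T] [IsLocalRing T]
    [Algebra R T] [Algebra (MvPolynomial ι R) T] [IsScalarTower R (MvPolynomial ι R) T]
    [IsLocalization.AtPrime T 𝔫] (h : ∀ p, X p - C (c p) ∈ 𝔫) :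
    ∃ π : T →ₐ[R] R, IsRegularCoordinateSystem π fun p ↦
      algebraMap (MvPolynomial ι R) T (X p - C (c p)) := by
  set x : ι → T := fun p ↦ algebraMap (MvPolynomial ι R) T (X p - C (c p)) with hx
  have hC (z : R) : algebraMap (MvPolynomial ι R) T (C z) = algebraMap R T z :=
    (IsScalarTower.algebraMap_apply R (MvPolynomial ι R) T z).symm
  let π : T →ₐ[R] R := IsLocalization.liftAlgHom (M := 𝔫.primeCompl)
    (f := (aeval c : MvPolynomial ι R →ₐ[R] R)) fun z ↦ isUnit_aeval_of_notMem h z.2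
  have hπ (z : MvPolynomial ι R) : π (algebraMap _ T z) = aeval c z := by
    simp [π, IsLocalization.liftAlgHom_apply]
  refine ⟨π, le_antisymm (fun t ht ↦ ?_) (Ideal.span_le.mpr ?_), ?_, fun y hy ↦ ?_⟩
  · have h1 := ringHom_sub_mem_of_isLocalization 𝔫.primeCompl (φ := RingHom.id T)
      (ψ := (algebraMap R T).comp π.toRingHom) (I := Ideal.span (Set.range x))
      (ringHom_sub_mem_of_mvPolynomial
        (φ := (RingHom.id T).comp (algebraMap (MvPolynomial ι R) T))
        (ψ := ((algebraMap R T).comp π.toRingHom).comp (algebraMap (MvPolynomial ι R) T))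
        (by simp [hC]) fun p ↦ by
          have : x p ∈ Ideal.span (Set.range x) := Ideal.subset_span ⟨p, rfl⟩
          simpa [hx, hπ, hC] using this) t
    simpa [(RingHom.mem_ker).mp ht] using h1
  · rintro - ⟨p, rfl⟩
    simp only [SetLike.mem_coe, RingHom.mem_ker, x, hπ]
    simp
  · have := (isWeaklyRegular_map_X_sub_C c Finset.univ.toList
      (Finset.nodup_toList _)).of_isLocalization T 𝔫.primeCompl
    simpa [Function.comp_def, x] using this
  · let ρ : MvPolynomial ι R →ₐ[R] T := aeval fun p ↦ algebraMap R T (c p) + y p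
    have hρX (p : ι) : ρ (X p) - algebraMap (MvPolynomial ι R) T (X p) = (y - x) p := by
      simp [ρ, x, hC]
      ring
    have hρC (z : R) : ρ (C z) = algebraMap (MvPolynomial ι R) T (C z) := by
      rw [hC, ← MvPolynomial.algebraMap_eq, AlgHom.commutes]
    have hxm (p : ι) : x p ∈ IsLocalRing.maximalIdeal T :=
      (IsLocalization.AtPrime.to_map_mem_maximal_iff T 𝔫 _).mpr (h p)
    have hρ (z : MvPolynomial ι R) : ρ z - algebraMap _ T z ∈ Ideal.span (Set.range (y - x)) :=
      ringHom_sub_mem_of_mvPolynomial (φ := ρ.toRingHom) hρC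
        (fun p ↦ Ideal.subset_span (Set.mem_range.mpr ⟨p, (hρX p).symm⟩)) z
    have hle : Ideal.span (Set.range (y - x)) ≤ IsLocalRing.maximalIdeal T := by
      refine Ideal.span_le.mpr ?_
      rintro - ⟨p, rfl⟩
      exact Ideal.sub_mem _ (hy p) (hxm p)
    let τ : T →ₐ[R] T := IsLocalization.liftAlgHom (M := 𝔫.primeCompl) (f := ρ) fun z ↦ by
      by_contra hz
      have h1 : algebraMap _ T z.1 ∈ IsLocalRing.maximalIdeal T := by
        have := Ideal.sub_mem _ ((IsLocalRing.mem_maximalIdeal _).mpr hz) (hle (hρ z))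
        simpa using this
      exact z.2 ((IsLocalization.AtPrime.to_map_mem_maximal_iff T 𝔫 _).mp h1)
    have hτ (z : MvPolynomial ι R) : τ (algebraMap _ T z) = ρ z := by
      simp [τ, IsLocalization.liftAlgHom_apply]
    refine ⟨τ, fun p ↦ ?_, ringHom_sub_mem_of_isLocalization 𝔫.primeCompl (φ := τ.toRingHom)
      (ψ := RingHom.id T) (fun z ↦ by simpa [hτ] using hρ z)⟩
    simp only [x, hτ]
    rw [map_sub, hρC, hC]
    simp [ρ]

end Localization

theorem mem_map_colon_iff_of_isLocalization {S T : Type*} [CommRing S] [CommRing T] [Algebra S T]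
    (M : Submonoid S) [IsLocalization M T] {r : ℕ} {g : Fin r → S} {𝔟 J : Ideal S}
    (hJ : ∀ z, z ∈ J ↔ ∀ i, z * g i ∈ 𝔟) (t : T) :
    t ∈ J.map (algebraMap S T) ↔ ∀ i, t * algebraMap S T (g i) ∈ 𝔟.map (algebraMap S T) := by
  obtain ⟨z, m, rfl⟩ := IsLocalization.exists_mk'_eq M t
  have h (i : Fin r) : IsLocalization.mk' T z m * algebraMap S T (g i) =
      IsLocalization.mk' T (z * g i) m := by
    rw [mul_comm, IsLocalization.mul_mk'_eq_mk'_of_mul, mul_comm]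
  simp only [h, IsLocalization.mk'_mem_map_algebraMap_iff M, hJ]
  constructor
  · rintro ⟨n, hn, H⟩ i
    exact ⟨n, hn, by simpa [mul_assoc] using H i⟩
  · intro H
    choose n hn H using H
    refine ⟨∏ i, n i, Submonoid.prod_mem _ fun i _ ↦ hn i, fun i ↦ ?_⟩
    obtain ⟨d, hd⟩ := Finset.dvd_prod_of_mem n (Finset.mem_univ i)
    rw [hd]
    convert 𝔟.mul_mem_left d (H i) using 1
    ring

theorem isRegular_finRange_of_isWeaklyRegular {T M : Type*} [CommRing T] [IsLocalRing T]
    [AddCommGroup M] [Module T M] [IsNoetherian T M] [Nontrivial M] {r s : ℕ}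
    {x : Fin r × Fin s → T} (hx : ∀ p, x p ∈ IsLocalRing.maximalIdeal T)
    (hreg : RingTheory.Sequence.IsWeaklyRegular M (Finset.univ.toList.map x)) :
    RingTheory.Sequence.IsRegular M
      ((List.finRange r).flatMap fun i ↦ (List.finRange s).map fun j ↦ x (i, j)) := by
  have hlist : ((List.finRange r).flatMap fun i ↦ (List.finRange s).map fun j ↦ x (i, j)) =
      ((List.finRange r).product (List.finRange s)).map x := by
    simp [List.product, List.map_flatMap, Function.comp_def]
  have hperm : (Finset.univ : Finset (Fin r × Fin s)).toList.Perm
      ((List.finRange r).product (List.finRange s)) :=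
    (List.perm_ext_iff_of_nodup (Finset.nodup_toList _)
      ((List.nodup_finRange r).product (List.nodup_finRange s))).mpr fun p ↦ by
        simpa using List.mem_product.mpr ⟨List.mem_finRange p.1, List.mem_finRange p.2⟩
  rw [hlist]
  have hmem (l : List (Fin r × Fin s)) : ∀ z ∈ l.map x, z ∈ IsLocalRing.maximalIdeal T := by
    intro z hz
    obtain ⟨p, -, rfl⟩ := List.mem_map.mp hz
    exact hx p
  exact IsLocalRing.isRegular_of_perm
    (.of_isWeaklyRegular_of_mem_maximalIdeal M (hmem _) hreg) (hperm.map x)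

theorem mem_genericResidual_iff {R : Type*} [CommRing R] {r s : ℕ} {f : Fin r → R}
    {z : MvPolynomial (Fin r × Fin s) R} :
    z ∈ genericResidual r s f ↔ ∀ i, z * C (f i) ∈ Ideal.span (Set.range fun j : Fin s =>
      ∑ i : Fin r, (X (i, j) : MvPolynomial (Fin r × Fin s) R) * C (f i)) := by
  rw [genericResidual, Ideal.map_span, ← Set.range_comp]
  exact mem_colon_span_range_iff

/-- The deformation statement for an arbitrary model `T` of the localization. -/
theorem IsCohenMacaulayLocalRing.deformation_genericResidual {R : Type*} [CommRing R]
    [IsNoetherianRing R] [IsLocalRing R] (hCM : IsCohenMacaulayLocalRing R) {r s : ℕ}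
    {f : Fin r → R} {c : Fin r → Fin s → R} {J : Ideal R}
    (hJ : J = Submodule.colon (Ideal.span (Set.range fun j : Fin s => ∑ i : Fin r, c i j * f i))
      (Ideal.span (Set.range f)))
    (hJproper : J ≠ ⊤) (hJht : (s : ℕ∞) ≤ idealHeight J)
    (hs : (s : ℕ∞) ≤ idealHeight (Ideal.span (Set.range f)) + 1)
    {𝔫 : Ideal (MvPolynomial (Fin r × Fin s) R)} [𝔫.IsMaximal]
    {x : Fin r × Fin s → MvPolynomial (Fin r × Fin s) R} (hx : ∀ p, x p = X p - C (c p.1 p.2))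
    (hxn : ∀ p, x p ∈ 𝔫) (T : Type*) [CommRing T] [IsLocalRing T] [Algebra R T]
    [Algebra (MvPolynomial (Fin r × Fin s) R) T]
    [IsScalarTower R (MvPolynomial (Fin r × Fin s) R) T] [IsLocalization.AtPrime T 𝔫] :
    Nonempty ((T ⧸ (genericResidual r s f ⊔ Ideal.span (Set.range x)).map
        (algebraMap (MvPolynomial (Fin r × Fin s) R) T)) ≃+* (R ⧸ J)) ∧
      RingTheory.Sequence.IsRegular T
        ((List.finRange r).flatMap fun i => (List.finRange s).map fun j =>
          algebraMap (MvPolynomial (Fin r × Fin s) R) T (x (i, j))) ∧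
      RingTheory.Sequence.IsRegular
        (T ⧸ (genericResidual r s f).map (algebraMap (MvPolynomial (Fin r × Fin s) R) T))
        ((List.finRange r).flatMap fun i => (List.finRange s).map fun j =>
          algebraMap (MvPolynomial (Fin r × Fin s) R) T (x (i, j))) := by
  obtain rfl : x = fun p ↦ X p - C (c p.1 p.2) := funext hx
  have : IsNoetherianRing T := IsLocalization.isNoetherianRing 𝔫.primeCompl T inferInstance
  let S := MvPolynomial (Fin r × Fin s) R
  let x : Fin r × Fin s → T := fun p ↦ algebraMap S T (X p - C (c p.1 p.2))
  let K : Ideal T := (genericResidual r s f).map (algebraMap S T)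
  have hxm (p) : x p ∈ IsLocalRing.maximalIdeal T :=
    (IsLocalization.AtPrime.to_map_mem_maximal_iff T 𝔫 _).mpr (hxn p)
  have hC (z : R) : algebraMap S T (C z) = algebraMap R T z :=
    (IsScalarTower.algebraMap_apply R S T z).symm
  obtain ⟨π, hπ⟩ : ∃ π : T →ₐ[R] R, IsRegularCoordinateSystem π x := by
    apply exists_isRegularCoordinateSystem (c := fun p ↦ c p.1 p.2) (𝔫 := 𝔫) T
    exact hxn
  have hK (y : T) : y ∈ K ↔ ∀ i, y * algebraMap R T (f i) ∈ Ideal.span (Set.range fun j ↦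
      ∑ i, (algebraMap R T (c i j) + x (i, j)) * algebraMap R T (f i)) := by
    simp only [K]
    rw [mem_map_colon_iff_of_isLocalization 𝔫.primeCompl
      (fun z ↦ mem_genericResidual_iff), Ideal.map_span, ← Set.range_comp]
    simp [Function.comp_def, x, S, hC]
  obtain ⟨hreg, hsup⟩ := hCM.isWeaklyRegular_quotient_colon hπ (c := fun p ↦ c p.1 p.2) rfl rfl
    (hJ ▸ hJproper) (hJ ▸ hJht) hs hK
  rw [← hJ] at hsup
  have hmap : (genericResidual r s f ⊔ Ideal.span (Set.range fun p : Fin r × Fin s ↦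
      (X p - C (c p.1 p.2) : S))).map (algebraMap S T) = K ⊔ Ideal.span (Set.range x) := by
    rw [Ideal.map_sup, Ideal.map_span, ← Set.range_comp]
    rfl
  have : Nontrivial (T ⧸ K) := Ideal.Quotient.nontrivial_iff.mpr fun h ↦ by
    refine hJproper ((Ideal.eq_top_iff_one _).mpr ?_)
    rw [h, top_sup_eq] at hsup
    have h1 : (1 : T) ∈ (⊤ : Ideal T) := trivial
    rwa [hsup, Ideal.mem_comap, map_one] at h1
  refine ⟨⟨?_⟩, isRegular_finRange_of_isWeaklyRegular hxm hπ.isWeaklyRegular,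
    isRegular_finRange_of_isWeaklyRegular hxm hreg⟩
  have hker : RingHom.ker ((Ideal.Quotient.mk J).comp π.toRingHom) = J.comap π := by
    rw [← RingHom.comap_ker, Ideal.mk_ker]
    rfl
  exact (Ideal.quotEquivOfEq (hmap.trans (hsup.trans hker.symm))).trans
    (RingHom.quotientKerEquivOfSurjective
      (Ideal.Quotient.mk_surjective.comp fun y ↦ ⟨algebraMap R T y, by simp⟩))

/-- **Corollary 4.8 (deformation of residual intersections).**
Let `(R, 𝔪)` be a Cohen–Macaulay Noetherian local ring,
`𝔞 = (a₁, …, a_s) ⊆ I = (f₁, …, f_r)` with `a_j = Σᵢ c_{ij} fᵢ`, and suppose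
`J = 𝔞 :_R I` is an `s`-residual intersection of `I` (proper with `ht J ≥ s`) with
`s ≤ ht I + 1`.  Let `S = R[U_{ij}]`, `a'_j = Σᵢ U_{ij} fᵢ`,
`R(s, f) = (a'₁, …, a'_s) :_S IS` and `x = U_{11} − c_{11}, …, U_{rs} − c_{rs}`.
Then for every maximal ideal `𝔫` of `S` containing `R(s, f) + (x)` there is a ring
isomorphism `S_𝔫/(R(s, f) + (x))S_𝔫 ≅ R/J`; together with the regularity of `x` on
`S_𝔫` and on `S_𝔫/R(s, f)S_𝔫`, this says `(S_𝔫, R(s, f)S_𝔫)` is a deformation of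
`(R, J)`. -/
theorem statement10 {R : Type*} [CommRing R] [IsNoetherianRing R] [IsLocalRing R]
    (hCM : IsCohenMacaulayLocalRing R)
    {r s : ℕ} (f : Fin r → R) (c : Fin r → Fin s → R)
    (hJproper : Submodule.colon
        (Ideal.span (Set.range fun j : Fin s => ∑ i : Fin r, c i j * f i))
        (Ideal.span (Set.range f)) ≠ ⊤)
    (hJht : (s : ℕ∞) ≤ idealHeight (Submodule.colon
        (Ideal.span (Set.range fun j : Fin s => ∑ i : Fin r, c i j * f i))
        (Ideal.span (Set.range f))))
    (hs : (s : ℕ∞) ≤ idealHeight (Ideal.span (Set.range f)) + 1)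
    (𝔫 : Ideal (MvPolynomial (Fin r × Fin s) R)) (h𝔫 : 𝔫.IsMaximal)
    (h𝔫sub : genericResidual r s f ⊔
      Ideal.span (Set.range fun p : Fin r × Fin s =>
        (X p : MvPolynomial (Fin r × Fin s) R) - C (c p.1 p.2)) ≤ 𝔫) :
    haveI : 𝔫.IsPrime := h𝔫.isPrime
    (Nonempty
      ((Localization.AtPrime 𝔫 ⧸
          (genericResidual r s f ⊔
            Ideal.span (Set.range fun p : Fin r × Fin s =>
              (X p : MvPolynomial (Fin r × Fin s) R) - C (c p.1 p.2))).map
            (algebraMap (MvPolynomial (Fin r × Fin s) R) (Localization.AtPrime 𝔫)))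
        ≃+*
        (R ⧸ Submodule.colon
          (Ideal.span (Set.range fun j : Fin s => ∑ i : Fin r, c i j * f i))
          (Ideal.span (Set.range f)))) ∧
      RingTheory.Sequence.IsRegular (Localization.AtPrime 𝔫)
        ((List.finRange r).flatMap fun i => (List.finRange s).map fun j =>
          algebraMap (MvPolynomial (Fin r × Fin s) R) (Localization.AtPrime 𝔫)
            ((X (i, j) : MvPolynomial (Fin r × Fin s) R) - C (c i j))) ∧
      RingTheory.Sequence.IsRegular
        (Localization.AtPrime 𝔫 ⧸ (genericResidual r s f).map
          (algebraMap (MvPolynomial (Fin r × Fin s) R) (Localization.AtPrime 𝔫)))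
        ((List.finRange r).flatMap fun i => (List.finRange s).map fun j =>
          algebraMap (MvPolynomial (Fin r × Fin s) R) (Localization.AtPrime 𝔫)
            ((X (i, j) : MvPolynomial (Fin r × Fin s) R) - C (c i j)))) := by
  have hx (p : Fin r × Fin s) : (X p - C (c p.1 p.2) : MvPolynomial (Fin r × Fin s) R) ∈ 𝔫 :=
    h𝔫sub (Ideal.mem_sup_right (Ideal.subset_span ⟨p, rfl⟩))
  exact hCM.deformation_genericResidual rfl hJproper hJht hs (fun _ ↦ rfl) hx
    (Localization.AtPrime 𝔫)
end

section
/- Let R be a commutative ring, let f_1, …, f_r ∈ R generate the ideal I = (f_1, …, f_r), let s be a positive integer, let c_{ij} ∈ R (1 ≤ i ≤ r, 1 ≤ j ≤ s), and set a_j = Σ_{i=1}^r c_{ij} f_i and 𝔞 = (a_1, …, a_s). Let S = R[U_{ij} : 1 ≤ i ≤ r, 1 ≤ j ≤ s] be the polynomial ring over R in rs indeterminates, set a'_j = Σ_{i=1}^r U_{ij} f_i and R(s, f) = (a'_1, …, a'_s) :_S IS, and let x denote the sequence U_{11} − c_{11}, …, U_{rs} − c_{rs} in S. If the sum of ideals R(s,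 f) + (x) equals the whole ring S, then 𝔞 = I. -/
open MvPolynomial

/-- Let `R` be a commutative ring, `I = (f₁, …, f_r)`, `s > 0`, `c_{ij} ∈ R`,
`a_j = Σᵢ c_{ij} fᵢ` and `𝔞 = (a₁, …, a_s)`.  Let `S = R[U_{ij}]`,
`a'_j = Σᵢ U_{ij} fᵢ`, `R(s, f) = (a'₁, …, a'_s) :_S IS` and
`x = U_{11} − c_{11}, …, U_{rs} − c_{rs}`.  If `R(s, f) + (x) = S`, then `𝔞 = I`. -/
theorem statement11 {R : Type*} [CommRing R] {r s : ℕ} (hs : 0 < s)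
    (f : Fin r → R) (c : Fin r → Fin s → R)
    (htop : genericResidual r s f ⊔
      Ideal.span (Set.range fun p : Fin r × Fin s =>
        (X p : MvPolynomial (Fin r × Fin s) R) - C (c p.1 p.2)) = ⊤) :
    Ideal.span (Set.range fun j : Fin s => ∑ i : Fin r, c i j * f i) =
      Ideal.span (Set.range f) := by
  have h_one : (1 : MvPolynomial (Fin r × Fin s) R) ∈ genericResidual r s f ⊔
      Ideal.span (Set.range fun p : Fin r × Fin s =>
        (X p : MvPolynomial (Fin r × Fin s) R) - C (c p.1 p.2)) := htop ▸ Submodule.mem_top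
  obtain ⟨g, hg, h, hh, hgh⟩ := Submodule.mem_sup.mp h_one
  let φ : MvPolynomial (Fin r × Fin s) R →+* R := eval fun p => c p.1 p.2
  have hφh : φ h = 0 := by
    refine RingHom.mem_ker.mp ((Ideal.span_le (I := RingHom.ker φ)).mpr ?_ hh)
    rintro _ ⟨p, rfl⟩
    simp [φ, RingHom.mem_ker]
  have hφg : φ g = 1 := by simpa [hφh] using congrArg φ hgh
  apply le_antisymm <;> rw [Ideal.span_le] <;> rintro _ ⟨k, rfl⟩
  · exact Ideal.sum_mem _ fun i _ =>
      Ideal.mul_mem_left _ _ (Ideal.subset_span (Set.mem_range_self i))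
  · have hgk := Submodule.mem_colon.mp hg (C (f k))
      (Ideal.mem_map_of_mem C (Ideal.subset_span (Set.mem_range_self k)))
    have hφgk := Ideal.mem_map_of_mem φ hgk
    rw [Ideal.map_span, ← Set.range_comp] at hφgk
    have hφC : φ (C (f k)) = f k := eval_C _
    simpa [hφg, hφC, φ, Function.comp_def] using hφgk
end
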